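/- arXiv:2010.12545 — 2 statements merged into one kernel-verified Lean document; each statement's English description precedes it below -/
import Mathlib

section
/- Fix a ∈ ℝ, b = 8π, and ρ > 0 with √ρ ∈ ℚ. Consider the complex vector space of pairs (f, g) of smooth Γ-invariant functions ℝ⁴ → ℂ satisfying −V̄₂(f) + V̄₁(g) + (b/4)·g = 0 and ρ·V₁(f) + V₂(g) = 0 everywhere on ℝ⁴. Then this space has complex dimension 4 if √ρ ∈ ℤ, and complex dimension 2 if √ρ ∈ ℚ\ℤ. In particular its dimension is not independent of ρ. -/
/-- `Γ`-invariance: `F(t,x,y,z) = F(t+α, x+ξ, y+β, z+γ+ξy)` for all integers `α, ξ, β, γ`.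
Such functions are precisely the functions on the Kodaira–Thurston manifold. -/
def GammaInvariant (F : ℝ × ℝ × ℝ × ℝ → ℂ) : Prop :=
  ∀ (t x y z : ℝ) (α ξ β γ : ℤ),
    F (t + α, x + ξ, y + β, z + γ + ξ * y) = F (t, x, y, z)

/-- `∂_t F`. -/
noncomputable def dT (F : ℝ × ℝ × ℝ × ℝ → ℂ) (p : ℝ × ℝ × ℝ × ℝ) : ℂ :=
  fderiv ℝ F p (1, 0, 0, 0)

/-- `∂_x F`. -/
noncomputable def dX (F : ℝ × ℝ × ℝ × ℝ → ℂ) (p : ℝ × ℝ × ℝ × ℝ) : ℂ :=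
  fderiv ℝ F p (0, 1, 0, 0)

/-- `∂_y F`. -/
noncomputable def dY (F : ℝ × ℝ × ℝ × ℝ → ℂ) (p : ℝ × ℝ × ℝ × ℝ) : ℂ :=
  fderiv ℝ F p (0, 0, 1, 0)

/-- `∂_z F`. -/
noncomputable def dZ (F : ℝ × ℝ × ℝ × ℝ → ℂ) (p : ℝ × ℝ × ℝ × ℝ) : ℂ :=
  fderiv ℝ F p (0, 0, 0, 1)

/-- `V₁ = ½(∂_t − i∂_x)`. -/
noncomputable def V₁ (F : ℝ × ℝ × ℝ × ℝ → ℂ) (p : ℝ × ℝ × ℝ × ℝ) : ℂ :=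
  (1 / 2 : ℂ) * (dT F p - Complex.I * dX F p)

/-- `V̄₁ = ½(∂_t + i∂_x)`. -/
noncomputable def V₁bar (F : ℝ × ℝ × ℝ × ℝ → ℂ) (p : ℝ × ℝ × ℝ × ℝ) : ℂ :=
  (1 / 2 : ℂ) * (dT F p + Complex.I * dX F p)

/-- `V₂ = ½(∂_y + x∂_z − ((a−i)/b)∂_z)`. -/
noncomputable def V₂ (a b : ℝ) (F : ℝ × ℝ × ℝ × ℝ → ℂ) (p : ℝ × ℝ × ℝ × ℝ) : ℂ :=
  (1 / 2 : ℂ) * (dY F p + (p.2.1 : ℂ) * dZ F p - (((a : ℂ) - Complex.I) / (b : ℂ)) * dZ F p)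

/-- `V̄₂ = ½(∂_y + x∂_z − ((a+i)/b)∂_z)`. -/
noncomputable def V₂bar (a b : ℝ) (F : ℝ × ℝ × ℝ × ℝ → ℂ) (p : ℝ × ℝ × ℝ × ℝ) : ℂ :=
  (1 / 2 : ℂ) * (dY F p + (p.2.1 : ℂ) * dZ F p - (((a : ℂ) + Complex.I) / (b : ℂ)) * dZ F p)

/-- The space of pairs `(f, g)` of smooth `Γ`-invariant functions `ℝ⁴ → ℂ` solving the
`∂̄`-harmonic `(0,1)`-form equations `−V̄₂(f) + V̄₁(g) + (b/4)g = 0` and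
`ρV₁(f) + V₂(g) = 0`. -/
def solutionSet (a b ρ : ℝ) :
    Set (((ℝ × ℝ × ℝ × ℝ) → ℂ) × ((ℝ × ℝ × ℝ × ℝ) → ℂ)) :=
  {fg | ContDiff ℝ (⊤ : ℕ∞) fg.1 ∧ ContDiff ℝ (⊤ : ℕ∞) fg.2 ∧
    GammaInvariant fg.1 ∧ GammaInvariant fg.2 ∧
    ∀ q : ℝ × ℝ × ℝ × ℝ,
      -(V₂bar a b fg.1 q) + V₁bar fg.2 q + ((b : ℂ) / 4) * fg.2 q = 0 ∧
      (ρ : ℂ) * V₁ fg.1 q + V₂ a b fg.2 q = 0}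

theorem exists_int_eq_power_sum {x y : ℝ} {s t : ℤ} (hs : x + y = s) (ht : x * y = t) (k : ℕ) :
    ∃ c : ℤ, x ^ k + y ^ k = c := by
  induction k using Nat.twoStepInduction with
  | zero => exact ⟨2, by norm_num⟩
  | one => exact ⟨s, by simpa using hs⟩
  | more k h₀ h₁ =>
    obtain ⟨c₀, h₀⟩ := h₀
    obtain ⟨c₁, h₁⟩ := h₁
    refine ⟨s * c₁ - t * c₀, ?_⟩
    push_cast
    rw [← h₀, ← h₁, ← hs, ← ht]
    ring

theorem exists_int_eq_I_pow_re (k : ℕ) : ∃ c : ℤ, (Complex.I ^ k).re = c := by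
  have h : ∃ c d : ℤ, Complex.I ^ k = c + d * Complex.I := by
    induction k with
    | zero => exact ⟨1, 0, by simp⟩
    | succ k ih =>
      obtain ⟨c, d, h⟩ := ih
      refine ⟨-d, c, ?_⟩
      rw [pow_succ, h]
      push_cast
      linear_combination (d : ℂ) * Complex.I_mul_I
  obtain ⟨c, d, h⟩ := h
  exact ⟨c, by simp [h]⟩

/-- Clearing denominators in a sum of values of an integer polynomial at three points of the
imaginary axis whose power sums, after scaling by `M`, are integers. -/
theorem exists_int_eq_sum_aeval_re {M : ℤ} (hM : M ≠ 0) {x y z : ℝ}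
    (h : ∀ k : ℕ, ∃ c : ℤ, x ^ k + y ^ k + z ^ k = c) (g : Polynomial ℤ) {d : ℕ}
    (hd : g.natDegree ≤ d) :
    ∃ c : ℤ, (M : ℝ) ^ d * ((Polynomial.aeval (Complex.I * ((x / M : ℝ) : ℂ)) g).re +
      (Polynomial.aeval (Complex.I * ((y / M : ℝ) : ℂ)) g).re +
      (Polynomial.aeval (Complex.I * ((z / M : ℝ) : ℂ)) g).re) = c := by
  have hM' : (M : ℝ) ≠ 0 := by exact_mod_cast hM
  have key (u : ℝ) : (Polynomial.aeval (Complex.I * ((u / M : ℝ) : ℂ)) g).re =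
      ∑ k ∈ Finset.range (d + 1), g.coeff k * ((Complex.I ^ k).re * (u / M) ^ k) := by
    rw [Polynomial.aeval_eq_sum_range' (Nat.lt_succ_of_le hd), Complex.re_sum]
    refine Finset.sum_congr rfl fun k _ => ?_
    rw [mul_pow, ← Complex.ofReal_pow, zsmul_eq_mul, ← Complex.ofReal_intCast,
      Complex.re_ofReal_mul, Complex.re_mul_ofReal]
  choose c hc using h
  choose e he using exists_int_eq_I_pow_re
  refine ⟨∑ k ∈ Finset.range (d + 1), g.coeff k * e k * M ^ (d - k) * c k, ?_⟩
  rw [key, key, key, ← Finset.sum_add_distrib, ← Finset.sum_add_distrib, Finset.mul_sum]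
  push_cast
  refine Finset.sum_congr rfl fun k hk => ?_
  have hk' : k ≤ d := Nat.lt_succ_iff.mp (Finset.mem_range.mp hk)
  rw [← hc, he]
  have hp : (M : ℝ) ^ d = M ^ (d - k) * M ^ k := by rw [← pow_add, Nat.sub_add_cancel hk']
  rw [hp]
  simp only [div_pow]
  field_simp

theorem aeval_prod_sq_add_sq (M s t : ℤ) (x y : ℝ) (hs : x + y = s) (ht : x * y = t) (u : ℂ) :
    Polynomial.aeval u ((Polynomial.C (M ^ 4) * Polynomial.X ^ 4 +
      Polynomial.C (M ^ 2 * (s ^ 2 - 2 * t)) * Polynomial.X ^ 2 + Polynomial.C (t ^ 2)) *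
      (Polynomial.C (M ^ 2) * Polynomial.X ^ 2 + Polynomial.C (s ^ 2)) : Polynomial ℤ) =
    ((M * u) ^ 2 + x ^ 2) * ((M * u) ^ 2 + y ^ 2) * ((M * u) ^ 2 + s ^ 2) := by
  have hs' : (s : ℂ) = x + y := by rw [← Complex.ofReal_intCast, ← hs]; push_cast; rfl
  have ht' : (t : ℂ) = x * y := by rw [← Complex.ofReal_intCast, ← ht]; push_cast; rfl
  simp only [map_mul, map_add, map_sub, map_pow, Polynomial.aeval_X, eq_intCast, map_intCast,
    map_ofNat]
  rw [ht', hs']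
  ring

/-- `π` is not a quadratic irrational (here: with nonzero trace and norm). -/
theorem pi_not_quadratic {M s t : ℤ} (hM : M ≠ 0) (hs : s ≠ 0) (ht : t ≠ 0) :
    (M * Real.pi) ^ 2 - s * (M * Real.pi) + t ≠ 0 := by
  intro h
  set x : ℝ := M * Real.pi with hx
  set y : ℝ := s - x with hy
  have hM' : (M : ℝ) ≠ 0 := by exact_mod_cast hM
  have hMc : (M : ℂ) ≠ 0 := by exact_mod_cast hM
  have hxy : x + y = s := by rw [hy]; ring
  have hxy' : x * y = t := by rw [hy]; linear_combination -h
  set f : Polynomial ℤ := (Polynomial.C (M ^ 4) * Polynomial.X ^ 4 +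
      Polynomial.C (M ^ 2 * (s ^ 2 - 2 * t)) * Polynomial.X ^ 2 + Polynomial.C (t ^ 2)) *
      (Polynomial.C (M ^ 2) * Polynomial.X ^ 2 + Polynomial.C (s ^ 2)) with hf
  have hf0 : f.eval 0 = t ^ 2 * s ^ 2 := by simp [hf]
  have hf0' : f.eval 0 ≠ 0 := by rw [hf0]; positivity
  have hfdeg : f.natDegree ≤ 6 := by rw [hf]; compute_degree
  have hfne : f ≠ 0 := by
    intro h0
    rw [h0] at hf0'
    simp at hf0'
  have hroot (v : ℝ) (hv : v = x ∨ v = y ∨ v = s) :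
      Complex.I * ((v / M : ℝ) : ℂ) ∈ f.aroots ℂ := by
    rw [Polynomial.mem_aroots]
    refine ⟨hfne, ?_⟩
    rw [hf, aeval_prod_sq_add_sq M s t x y hxy hxy']
    have e : ((M : ℂ) * (Complex.I * ((v / M : ℝ) : ℂ))) ^ 2 = -(v : ℂ) ^ 2 := by
      push_cast
      field_simp
      rw [Complex.I_sq]
      ring
    rw [e]
    rcases hv with rfl | rfl | rfl <;> simp
  have hexp : Complex.exp (Complex.I * ((x / M : ℝ) : ℂ)) +
      Complex.exp (Complex.I * ((y / M : ℝ) : ℂ)) +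
      Complex.exp (Complex.I * (((s : ℝ) / M : ℝ) : ℂ)) = -1 := by
    have e1 : Complex.exp (Complex.I * ((x / M : ℝ) : ℂ)) = -1 := by
      rw [hx, mul_div_cancel_left₀ _ hM', mul_comm, Complex.exp_pi_mul_I]
    have e2 : Complex.exp (Complex.I * (((s : ℝ) / M : ℝ) : ℂ)) =
        Complex.exp (Complex.I * ((x / M : ℝ) : ℂ)) *
          Complex.exp (Complex.I * ((y / M : ℝ) : ℂ)) := by
      rw [← Complex.exp_add, ← hxy]
      push_cast
      ring_nf
    rw [e2, e1]
    ring
  have hsum (k : ℕ) : ∃ c : ℤ, x ^ k + y ^ k + (s : ℝ) ^ k = c := by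
    obtain ⟨c, hc⟩ := exists_int_eq_power_sum hxy hxy' k
    exact ⟨c + s ^ k, by rw [hc]; push_cast; rfl⟩
  obtain ⟨c, hc⟩ := LindemannWeierstrass.exp_polynomial_approx f hf0'
  have hlim : Filter.Tendsto (fun p : ℕ => 3 * (|M| : ℝ) ^ 6 * |c| *
      ((((|M| : ℝ) ^ 6 * |c|) ^ p) / (p.factorial : ℝ))) Filter.atTop (nhds 0) := by
    simpa using (FloorSemiring.tendsto_pow_div_factorial_atTop ((|M| : ℝ) ^ 6 * |c|)).const_mul
      (3 * (|M| : ℝ) ^ 6 * |c|)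
  obtain ⟨N, hN⟩ := Filter.eventually_atTop.mp (hlim.eventually (gt_mem_nhds one_pos))
  obtain ⟨p, hpN, hp⟩ := Nat.exists_infinite_primes ((f.eval 0).natAbs + N + M.natAbs + 1)
  obtain ⟨n, hpn, g, hg, hap⟩ := hc p (by omega) hp
  have hdeg : g.natDegree ≤ 6 * p := by
    have : p * f.natDegree ≤ p * 6 := Nat.mul_le_mul_left p hfdeg
    omega
  obtain ⟨e, he⟩ := exists_int_eq_sum_aeval_re hM hsum g hdeg
  have hle : |(n : ℝ) + p * ((Polynomial.aeval (Complex.I * ((x / M : ℝ) : ℂ)) g).re +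
      (Polynomial.aeval (Complex.I * ((y / M : ℝ) : ℂ)) g).re +
      (Polynomial.aeval (Complex.I * (((s : ℝ) / M : ℝ) : ℂ)) g).re)| ≤
        3 * (c ^ p / ((p - 1).factorial : ℝ)) := by
    have h1 := hap (hroot x (Or.inl rfl))
    have h2 := hap (hroot y (Or.inr (Or.inl rfl)))
    have h3 := hap (hroot s (Or.inr (Or.inr rfl)))
    have h4 := (norm_add₃_le).trans (add_le_add (add_le_add h1 h2) h3)
    have h5 := (Complex.abs_re_le_norm _).trans h4
    refine le_trans (le_of_eq ?_) (h5.trans (le_of_eq (by ring)))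
    rw [← abs_neg]
    congr 1
    have h6 := congrArg (fun w : ℂ => ((n : ℝ) * w : ℂ).re) hexp
    simp only [Complex.re_ofReal_mul, Complex.add_re, Complex.neg_re, Complex.one_re] at h6
    simp only [zsmul_eq_mul, nsmul_eq_mul, Complex.add_re, Complex.sub_re,
      ← Complex.ofReal_intCast, ← Complex.ofReal_natCast, Complex.re_ofReal_mul]
    linarith
  have hpM : ¬ (p : ℤ) ∣ M := by
    intro hd
    have := Nat.le_of_dvd (Int.natAbs_pos.mpr hM) (Int.natCast_dvd.mp hd)
    omega
  have hint : M ^ (6 * p) * n + p * e ≠ 0 := by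
    intro h0
    have hd : (p : ℤ) ∣ M ^ (6 * p) * n :=
      (dvd_add_left (dvd_mul_right (p : ℤ) e)).mp (h0 ▸ dvd_zero _)
    rcases (Nat.prime_iff_prime_int.mp hp).dvd_or_dvd hd with h | h
    · exact hpM ((Nat.prime_iff_prime_int.mp hp).dvd_of_dvd_pow h)
    · exact hpn h
  have hone : (1 : ℝ) ≤ |(M : ℝ) ^ (6 * p) * n + p * e| := by
    exact_mod_cast Int.one_le_abs hint
  have hpos : 0 < p := hp.pos
  have hfin := hN (p - 1) (by omega)
  have hfact : (0 : ℝ) < ((p - 1).factorial : ℝ) := by exact_mod_cast Nat.factorial_pos _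
  have : |(M : ℝ) ^ (6 * p) * n + p * e| ≤ (|M| : ℝ) ^ (6 * p) *
      (3 * (|c| ^ p / ((p - 1).factorial : ℝ))) := by
    rw [← he, show ∀ u v w q : ℝ, u * v + w * (u * q) = u * (v + w * q) by intros; ring, abs_mul,
      abs_pow]
    gcongr
    rw [← abs_pow]
    refine hle.trans ?_
    gcongr
    exact le_abs_self _
  have heq : (|M| : ℝ) ^ (6 * p) * (3 * (|c| ^ p / ((p - 1).factorial : ℝ))) =
      3 * (|M| : ℝ) ^ 6 * |c| *
      ((((|M| : ℝ) ^ 6 * |c|) ^ (p - 1)) / ((p - 1).factorial : ℝ)) := by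
    obtain ⟨q, rfl⟩ : ∃ q, p = q + 1 := ⟨p - 1, by omega⟩
    simp only [Nat.add_sub_cancel]
    rw [pow_mul, mul_pow, pow_succ, pow_succ]
    ring
  linarith [heq ▸ this]

/-- All the functions `x ^ j * q x` are bounded. -/
def RapidlyDecaying (q : ℝ → ℂ) : Prop :=
  ∀ j : ℕ, ∃ C : ℝ, ∀ x : ℝ, ‖(x : ℂ) ^ j * q x‖ ≤ C

namespace RapidlyDecaying

theorem add {p q : ℝ → ℂ} (hp : RapidlyDecaying p) (hq : RapidlyDecaying q) :
    RapidlyDecaying fun x => p x + q x := fun j => by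
  obtain ⟨C, hC⟩ := hp j
  obtain ⟨D, hD⟩ := hq j
  refine ⟨C + D, fun x => ?_⟩
  rw [mul_add]
  exact norm_add_le_of_le (hC x) (hD x)

theorem const_mul {q : ℝ → ℂ} (hq : RapidlyDecaying q) (c : ℂ) :
    RapidlyDecaying fun x => c * q x := fun j => by
  obtain ⟨C, hC⟩ := hq j
  refine ⟨‖c‖ * C, fun x => ?_⟩
  rw [mul_left_comm, norm_mul]
  exact mul_le_mul_of_nonneg_left (hC x) (norm_nonneg c)

theorem id_mul {q : ℝ → ℂ} (hq : RapidlyDecaying q) :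
    RapidlyDecaying fun x => (x : ℂ) * q x := fun j => by
  obtain ⟨C, hC⟩ := hq (j + 1)
  exact ⟨C, fun x => by rw [← mul_assoc, ← pow_succ]; exact hC x⟩

theorem affine_mul {q : ℝ → ℂ} (hq : RapidlyDecaying q) (w v : ℂ) :
    RapidlyDecaying fun x => (w * x + v) * q x := by
  simpa only [add_mul, mul_assoc] using (hq.id_mul.const_mul w).add (hq.const_mul v)

theorem mul_of_norm_eq_one {q u : ℝ → ℂ} (hq : RapidlyDecaying q) (hu : ∀ x, ‖u x‖ = 1) :
    RapidlyDecaying fun x => u x * q x := fun j => by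
  obtain ⟨C, hC⟩ := hq j
  refine ⟨C, fun x => ?_⟩
  rw [mul_left_comm, norm_mul, hu, one_mul]
  exact hC x

end RapidlyDecaying

theorem second_deriv_eq_zero_of_nonneg_of_bounded {φ φ' φ'' : ℝ → ℝ}
    (h₁ : ∀ x, HasDerivAt φ (φ' x) x) (h₂ : ∀ x, HasDerivAt φ' (φ'' x) x)
    (hnn : ∀ x, 0 ≤ φ'' x) {C : ℝ} (hC : ∀ x, |φ x| ≤ C) (x : ℝ) : φ'' x = 0 := by
  have hmono : Monotone φ' := monotone_of_deriv_nonneg (fun x => (h₂ x).differentiableAt)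
    fun x => (h₂ x).deriv ▸ hnn x
  have htangent (a y : ℝ) : φ a + φ' a * (y - a) ≤ φ y := by
    have hcont : Continuous φ := continuous_iff_continuousAt.mpr fun x => (h₁ x).continuousAt
    rcases lt_trichotomy a y with h | rfl | h
    · obtain ⟨c, hc, hc'⟩ := exists_hasDerivAt_eq_slope φ φ' h hcont.continuousOn fun x _ => h₁ x
      rw [eq_div_iff (sub_pos.mpr h).ne'] at hc'
      nlinarith [hmono hc.1.le]
    · simp
    · obtain ⟨c, hc, hc'⟩ := exists_hasDerivAt_eq_slope φ φ' h hcont.continuousOn fun x _ => h₁ x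
      rw [eq_div_iff (sub_pos.mpr h).ne'] at hc'
      nlinarith [hmono hc.2.le]
  have hzero : φ' = fun _ => 0 := by
    funext a
    by_contra ha
    have h := htangent a (a + (2 * C + 1) / φ' a)
    rw [add_sub_cancel_left, mul_div_cancel₀ _ ha] at h
    linarith [abs_le.mp (hC a), abs_le.mp (hC (a + (2 * C + 1) / φ' a))]
  have h := h₂ x
  rw [hzero] at h
  exact h.unique (hasDerivAt_const x 0)

theorem hasDerivAt_re {q : ℝ → ℂ} {q' : ℂ} {x : ℝ} (h : HasDerivAt q q' x) :
    HasDerivAt (fun x => (q x).re) q'.re x :=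
  Complex.reCLM.hasFDerivAt.comp_hasDerivAt x h

theorem hasDerivAt_im {q : ℝ → ℂ} {q' : ℂ} {x : ℝ} (h : HasDerivAt q q' x) :
    HasDerivAt (fun x => (q x).im) q'.im x :=
  Complex.imCLM.hasFDerivAt.comp_hasDerivAt x h

/-- A bounded solution of `q'' = V q` with `1 ≤ re V` vanishes. -/
theorem eq_zero_of_bounded_of_one_le_re_potential {q q' V : ℝ → ℂ}
    (h₁ : ∀ x, HasDerivAt q (q' x) x) (h₂ : ∀ x, HasDerivAt q' (V x * q x) x)
    (hV : ∀ x, 1 ≤ (V x).re) {C : ℝ} (hC : ∀ x, ‖q x‖ ≤ C) (x : ℝ) : q x = 0 := by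
  have h := second_deriv_eq_zero_of_nonneg_of_bounded
    (φ := fun x => (q x).re ^ 2 + (q x).im ^ 2)
    (φ' := fun x => 2 * ((q x).re * (q' x).re + (q x).im * (q' x).im))
    (φ'' := fun x => 2 * ((q' x).re ^ 2 + (q' x).im ^ 2 +
      (V x).re * ((q x).re ^ 2 + (q x).im ^ 2))) (C := C ^ 2)
    (fun x => by
      convert! ((hasDerivAt_re (h₁ x)).pow 2).add ((hasDerivAt_im (h₁ x)).pow 2) using 1
      simp; ring)
    (fun x => by
      convert! (((hasDerivAt_re (h₁ x)).mul (hasDerivAt_re (h₂ x))).add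
        ((hasDerivAt_im (h₁ x)).mul (hasDerivAt_im (h₂ x)))).const_mul 2 using 1
      simp; ring)
    (fun x => by have := hV x; positivity)
    (fun x => by
      rw [abs_of_nonneg (by positivity)]
      have h := pow_le_pow_left₀ (norm_nonneg _) (hC x) 2
      rwa [← Complex.normSq_eq_norm_sq, Complex.normSq_apply, ← pow_two, ← pow_two] at h) x
  have hVx := hV x
  have hle : (q x).re ^ 2 + (q x).im ^ 2 ≤ 0 := by
    nlinarith [sq_nonneg (q' x).re, sq_nonneg (q' x).im, sq_nonneg (q x).re, sq_nonneg (q x).im]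
  apply Complex.ext
  · simp only [Complex.zero_re]; nlinarith [sq_nonneg (q x).re, sq_nonneg (q x).im]
  · simp only [Complex.zero_im]; nlinarith [sq_nonneg (q x).re, sq_nonneg (q x).im]

/-- Spectral gap for the harmonic oscillator, in first-order form: `q₁ = (∂ + w x + v) q` and
`(∂ - w x - v) q₁ = μ q` have no rapidly decaying solutions unless `μ ∈ -2wℕ`. The induction
applies the lowering operator `∂ + w x + v`, which shifts `μ` by `2w`. -/
theorem eq_zero_of_lowering {w v : ℝ} (N : ℕ) {μ : ℂ} {q q₁ : ℝ → ℂ}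
    (hq : RapidlyDecaying q) (hq₁ : RapidlyDecaying q₁) (hN : w + 1 ≤ μ.re + 2 * w * N)
    (hμ : ∀ j : ℕ, μ ≠ -(2 * w * j))
    (h₁ : ∀ x : ℝ, HasDerivAt q (q₁ x - (w * x + v) * q x) x)
    (h₂ : ∀ x : ℝ, HasDerivAt q₁ ((w * x + v) * q₁ x + μ * q x) x) (x : ℝ) : q x = 0 := by
  have hv (x : ℝ) : HasDerivAt (fun x : ℝ => (w * x + v : ℂ)) w x := by
    simpa using ((Complex.ofRealCLM.hasDerivAt (x := x)).const_mul (w : ℂ)).add_const (v : ℂ)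
  induction N generalizing μ q q₁ x with
  | zero =>
    obtain ⟨C, hC⟩ := hq 0
    refine eq_zero_of_bounded_of_one_le_re_potential (V := fun x => μ - w + (w * x + v) ^ 2) h₁
      (fun x => ?_) (fun x => ?_) (C := C) (fun x => by simpa using hC x) x
    · convert! (h₂ x).sub ((hv x).mul (h₁ x)) using 1
      ring
    · have e : (μ - w + (w * x + v) ^ 2 : ℂ).re = μ.re - w + (w * x + v) ^ 2 := by
        rw [← Complex.ofReal_mul, ← Complex.ofReal_add, ← Complex.ofReal_pow]
        simp only [Complex.add_re, Complex.sub_re, Complex.ofReal_re]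
      rw [e]
      simp only [Nat.cast_zero, mul_zero, add_zero] at hN
      nlinarith [sq_nonneg (w * x + v)]
  | succ N ih =>
    have hq₁0 : ∀ x, q₁ x = 0 := by
      intro x
      refine ih (μ := μ + 2 * w) (q₁ := fun x => (w * x + v) * (2 * q₁ x) + μ * q x) hq₁
        (((hq₁.const_mul 2).affine_mul w v).add (hq.const_mul μ)) ?_ (fun j hj => ?_)
        (fun x => ?_) (fun x => ?_) x
      · have e : (2 * (w : ℂ)).re = 2 * w := by simp
        rw [Complex.add_re, e]
        push_cast at hN
        linarith
      · apply hμ (j + 1)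
        push_cast
        linear_combination hj
      · convert! h₂ x using 1
        ring
      · convert! ((hv x).mul ((h₂ x).const_mul 2)).add ((h₁ x).const_mul μ) using 1
        ring
    have h := h₂ x
    rw [show q₁ = fun _ => 0 from funext hq₁0] at h
    have h' := h.unique (hasDerivAt_const x 0)
    simp only [mul_zero, zero_add] at h'
    exact (mul_eq_zero.mp h').resolve_left (by simpa using hμ 0)

theorem eq_zero_of_oscillator_of_pos {w v : ℝ} (hw : 0 < w) {A B : ℂ} {p q : ℝ → ℂ}
    (hp : RapidlyDecaying p) (hq : RapidlyDecaying q) (hAB : ∀ j : ℕ, A * B ≠ -(2 * w * j))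
    (h₁ : ∀ x : ℝ, HasDerivAt p ((w * x + v) * p x + A * q x) x)
    (h₂ : ∀ x : ℝ, HasDerivAt q (-(w * x + v) * q x + B * p x) x) (x : ℝ) :
    p x = 0 ∧ q x = 0 := by
  obtain ⟨N, hN⟩ := exists_nat_ge ((w + 1 - (A * B).re) / (2 * w))
  rw [div_le_iff₀ (by positivity)] at hN
  have hq0 := eq_zero_of_lowering (v := v) N hq (hp.const_mul B) (by linarith) hAB
    (fun x => by convert! h₂ x using 1; ring)
    (fun x => by convert! (h₁ x).const_mul B using 1; ring)
  refine ⟨?_, hq0 x⟩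
  have h := h₂ x
  rw [show q = fun _ => 0 from funext hq0] at h
  have h' := h.unique (hasDerivAt_const x 0)
  simp only [mul_zero, zero_add] at h'
  exact (mul_eq_zero.mp h').resolve_left fun hB => hAB 0 (by simp [hB])

/-- The system `p' = v p + A q`, `q' = -v q + B p` with `v` real affine of slope `w ≠ 0` has no
rapidly decaying solutions unless `A * B ∈ -2|w|ℕ`. -/
theorem eq_zero_of_oscillator {w v : ℝ} (hw : w ≠ 0) {A B : ℂ} {p q : ℝ → ℂ}
    (hp : RapidlyDecaying p) (hq : RapidlyDecaying q)
    (hAB : ∀ j : ℕ, A * B ≠ -(2 * (|w| : ℝ) * j))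
    (h₁ : ∀ x : ℝ, HasDerivAt p ((w * x + v) * p x + A * q x) x)
    (h₂ : ∀ x : ℝ, HasDerivAt q (-(w * x + v) * q x + B * p x) x) (x : ℝ) :
    p x = 0 ∧ q x = 0 := by
  rcases hw.lt_or_gt with h | h
  · rw [abs_of_neg h] at hAB
    refine (eq_zero_of_oscillator_of_pos (w := -w) (v := -v) (neg_pos.mpr h) hq hp
      (fun j => mul_comm A B ▸ hAB j) (fun x => ?_) (fun x => ?_) x).symm
    · convert! h₂ x using 1
      push_cast; ring
    · convert! h₁ x using 1
      push_cast; ring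
  · rw [abs_of_pos h] at hAB
    exact eq_zero_of_oscillator_of_pos h hp hq hAB h₁ h₂ x

/-- The character `s ↦ exp (2πiks)` of `ℝ/ℤ`. -/
noncomputable def expMode (k : ℤ) (s : ℝ) : ℂ :=
  Complex.exp (2 * Real.pi * Complex.I * k * s)

theorem continuous_expMode (k : ℤ) : Continuous (expMode k) := by
  unfold expMode
  fun_prop

theorem norm_expMode (k : ℤ) (s : ℝ) : ‖expMode k s‖ = 1 := by
  rw [expMode, show (2 * Real.pi * Complex.I * k * s : ℂ) =
    ((2 * Real.pi * k * s : ℝ) : ℂ) * Complex.I by push_cast; ring]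
  exact Complex.norm_exp_ofReal_mul_I _

theorem expMode_ne_zero (k : ℤ) (s : ℝ) : expMode k s ≠ 0 := Complex.exp_ne_zero _

theorem expMode_add_intCast (k : ℤ) (s : ℝ) (j : ℤ) : expMode k (s + j) = expMode k s :=
  Complex.exp_eq_exp_iff_exists_int.mpr ⟨k * j, by push_cast; ring⟩

theorem expMode_neg_mul (k : ℤ) (s : ℝ) : expMode (-k) s * expMode k s = 1 := by
  rw [expMode, expMode, ← Complex.exp_add]
  push_cast
  ring_nf
  exact Complex.exp_zero

theorem expMode_one (k : ℤ) : expMode k 1 = expMode k 0 := by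
  simpa using expMode_add_intCast k 0 1

theorem hasDerivAt_expMode (k : ℤ) (s : ℝ) :
    HasDerivAt (expMode k) (2 * Real.pi * Complex.I * k * expMode k s) s := by
  have h : HasDerivAt (fun s : ℝ => 2 * Real.pi * Complex.I * k * s)
      (2 * Real.pi * Complex.I * k) s := by
    simpa using (Complex.ofRealCLM.hasDerivAt (x := s)).const_mul (2 * Real.pi * Complex.I * k)
  rw [mul_comm]
  exact h.cexp

/-- The `k`-th Fourier coefficient of a `1`-periodic function on `ℝ`. -/
noncomputable def modeCoeff (k : ℤ) (h : ℝ → ℂ) : ℂ :=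
  ∫ s in (0 : ℝ)..1, expMode (-k) s * h s

theorem modeCoeff_zero (k : ℤ) : modeCoeff k (fun _ => 0) = 0 := by simp [modeCoeff]

theorem modeCoeff_add (k : ℤ) {g h : ℝ → ℂ} (hg : Continuous g) (hh : Continuous h) :
    modeCoeff k (fun s => g s + h s) = modeCoeff k g + modeCoeff k h := by
  simp only [modeCoeff, mul_add]
  exact intervalIntegral.integral_add
    (((continuous_expMode _).mul hg).intervalIntegrable _ _)
    (((continuous_expMode _).mul hh).intervalIntegrable _ _)

theorem modeCoeff_const_mul (k : ℤ) (c : ℂ) (h : ℝ → ℂ) :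
    modeCoeff k (fun s => c * h s) = c * modeCoeff k h := by
  simp only [modeCoeff, mul_left_comm _ c, intervalIntegral.integral_const_mul]

theorem norm_modeCoeff_le (k : ℤ) {h : ℝ → ℂ} {C : ℝ} (hC : ∀ s, ‖h s‖ ≤ C) :
    ‖modeCoeff k h‖ ≤ C := by
  simpa [modeCoeff] using intervalIntegral.norm_integral_le_of_norm_le_const
    (a := 0) (b := 1) (C := C) (f := fun s => expMode (-k) s * h s)
    fun s _ => by rw [norm_mul, norm_expMode, one_mul]; exact hC s

theorem continuous_modeCoeff {X : Type*} [TopologicalSpace X] [FirstCountableTopology X] (k : ℤ)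
    {h : X → ℝ → ℂ} (hh : Continuous fun q : X × ℝ => h q.1 q.2) :
    Continuous fun x => modeCoeff k (h x) := by
  refine intervalIntegral.continuous_parametric_intervalIntegral_of_continuous' ?_ 0 1
  exact ((continuous_expMode _).comp continuous_snd).mul hh

theorem hasDerivAt_modeCoeff (k : ℤ) {h h' : ℝ → ℝ → ℂ}
    (hc : Continuous fun q : ℝ × ℝ => h q.1 q.2) (hc' : Continuous fun q : ℝ × ℝ => h' q.1 q.2)
    (hd : ∀ x s, HasDerivAt (fun x => h x s) (h' x s) x) (x : ℝ) :
    HasDerivAt (fun x => modeCoeff k (h x)) (modeCoeff k (h' x)) x := by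
  obtain ⟨C, hC⟩ := ((isCompact_Icc (a := x - 1) (b := x + 1)).prod
    (isCompact_Icc (a := (0 : ℝ)) (b := 1))).exists_bound_of_continuousOn hc'.continuousOn
  have hcont (y : ℝ) : Continuous fun s => expMode (-k) s * h y s :=
    (continuous_expMode _).mul (hc.comp (continuous_const.prodMk continuous_id))
  have hcont' (y : ℝ) : Continuous fun s => expMode (-k) s * h' y s :=
    (continuous_expMode _).mul (hc'.comp (continuous_const.prodMk continuous_id))
  refine (intervalIntegral.hasDerivAt_integral_of_dominated_loc_of_deriv_le
    (F := fun x s => expMode (-k) s * h x s) (F' := fun x s => expMode (-k) s * h' x s)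
    (bound := fun _ => C) (Icc_mem_nhds (sub_one_lt x) (lt_add_one x))
    (Filter.Eventually.of_forall fun y => (hcont y).aestronglyMeasurable)
    ((hcont x).intervalIntegrable _ _) (hcont' x).aestronglyMeasurable
    (Filter.Eventually.of_forall fun s hs y hy => ?_) intervalIntegrable_const
    (Filter.Eventually.of_forall fun s _ y _ => (hd y s).const_mul _)).2
  rw [norm_mul, norm_expMode, one_mul]
  rw [Set.uIoc_of_le zero_le_one] at hs
  exact hC (y, s) ⟨hy, Set.Ioc_subset_Icc_self hs⟩

theorem modeCoeff_deriv (k : ℤ) {h h' : ℝ → ℂ} (hd : ∀ s, HasDerivAt h (h' s) s)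
    (hc' : Continuous h') (h01 : h 1 = h 0) :
    modeCoeff k h' = 2 * Real.pi * Complex.I * k * modeCoeff k h := by
  have hc : Continuous h := continuous_iff_continuousAt.mpr fun s => (hd s).continuousAt
  have hu := continuous_expMode (-k)
  have h := intervalIntegral.integral_mul_deriv_eq_deriv_mul (a := 0) (b := 1)
    (fun s _ => hasDerivAt_expMode (-k) s) (fun s _ => hd s)
    ((continuous_const.mul hu).intervalIntegrable _ _) (hc'.intervalIntegrable _ _)
  rw [modeCoeff, h, h01, expMode_one, sub_self, zero_sub, ← intervalIntegral.integral_neg,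
    modeCoeff, ← intervalIntegral.integral_const_mul]
  refine intervalIntegral.integral_congr fun s _ => ?_
  push_cast
  ring

theorem modeCoeff_expMode (k l : ℤ) : modeCoeff k (expMode l) = if l = k then 1 else 0 := by
  split_ifs with h
  · subst h
    simp [modeCoeff, expMode_neg_mul]
  · have h' := modeCoeff_deriv k (hasDerivAt_expMode l)
      (continuous_const.mul (continuous_expMode l)) (expMode_one l)
    rw [modeCoeff_const_mul] at h'
    have h2 : (2 * Real.pi * Complex.I * (l - k) : ℂ) * modeCoeff k (expMode l) = 0 := by
      linear_combination h'
    refine (mul_eq_zero.mp h2).resolve_left ?_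
    simp [sub_eq_zero, h]

theorem modeCoeff_zero_comp_sub {h : ℝ → ℂ} (hp : Function.Periodic h 1) (a : ℝ) :
    modeCoeff 0 (fun s => h (s - a)) = modeCoeff 0 h := by
  simp only [modeCoeff, expMode, neg_zero, Int.cast_zero, mul_zero, zero_mul, Complex.exp_zero,
    one_mul]
  rw [intervalIntegral.integral_comp_sub_right, zero_sub, sub_eq_neg_add,
    hp.intervalIntegral_add_eq (-a) 0, zero_add]

theorem eq_zero_of_modeCoeff_eq_zero {h : ℝ → ℂ} (hc : Continuous h) (hp : Function.Periodic h 1)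
    (h0 : ∀ k, modeCoeff k h = 0) (s : ℝ) : h s = 0 := by
  let H : C(AddCircle (1 : ℝ), ℂ) :=
    ⟨hp.lift, continuous_coinduced_dom.mpr hc⟩
  have hcoeff : fourierCoeff H = fun _ => 0 := by
    funext k
    rw [fourierCoeff_eq_intervalIntegral _ _ 0, zero_add, div_one, one_smul, ← h0 k]
    refine intervalIntegral.integral_congr fun x _ => ?_
    simp only [fourier_coe_apply, smul_eq_mul, expMode]
    congr 2
    push_cast
    ring
  have h1 := has_pointwise_sum_fourier_series_of_summable (f := H)
    (hcoeff ▸ summable_zero) (s : AddCircle (1 : ℝ))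
  simp only [hcoeff, zero_smul] at h1
  exact (h1.unique hasSum_zero)

/-- Smooth functions on the Kodaira–Thurston manifold. -/
structure IsSmoothInvariant (F : ℝ × ℝ × ℝ × ℝ → ℂ) : Prop where
  contDiff : ContDiff ℝ (⊤ : ℕ∞) F
  invariant : GammaInvariant F

namespace IsSmoothInvariant

variable {F G : ℝ × ℝ × ℝ × ℝ → ℂ}

theorem continuous (hF : IsSmoothInvariant F) : Continuous F := hF.contDiff.continuous

theorem hasFDerivAt (hF : IsSmoothInvariant F) (p : ℝ × ℝ × ℝ × ℝ) :
    HasFDerivAt F (fderiv ℝ F p) p :=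
  (hF.contDiff.differentiable (by simp) p).hasFDerivAt

theorem add (hF : IsSmoothInvariant F) (hG : IsSmoothInvariant G) :
    IsSmoothInvariant fun p => F p + G p where
  contDiff := hF.contDiff.add hG.contDiff
  invariant t x y z α ξ β γ :=
    congrArg₂ (· + ·) (hF.invariant t x y z α ξ β γ) (hG.invariant t x y z α ξ β γ)

theorem const_mul (hF : IsSmoothInvariant F) (c : ℂ) : IsSmoothInvariant fun p => c * F p where
  contDiff := contDiff_const.mul hF.contDiff
  invariant t x y z α ξ β γ := congrArg (c * ·) (hF.invariant t x y z α ξ β γ)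

/-- The derivative of an invariant function transforms by the (unipotent) linear part of the
deck transformations. -/
theorem fderiv_translate (hF : IsSmoothInvariant F) (t x y z : ℝ) (α ξ β γ : ℤ)
    (v : ℝ × ℝ × ℝ × ℝ) :
    fderiv ℝ F (t + α, x + ξ, y + β, z + γ + ξ * y) (v.1, v.2.1, v.2.2.1, v.2.2.2 + ξ * v.2.2.1) =
      fderiv ℝ F (t, x, y, z) v := by
  have haff (u c : ℝ) : HasDerivAt (fun s : ℝ => u + s * c) c 0 := by
    simpa using ((hasDerivAt_id (0 : ℝ)).mul_const c).const_add u
  have hline : HasDerivAt (fun s : ℝ => (t + α + s * v.1, x + ξ + s * v.2.1, y + β + s * v.2.2.1,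
      z + γ + ξ * y + s * (v.2.2.2 + ξ * v.2.2.1)))
      (v.1, v.2.1, v.2.2.1, v.2.2.2 + ξ * v.2.2.1) 0 :=
    (haff _ _).prodMk ((haff _ _).prodMk ((haff _ _).prodMk (haff _ _)))
  have hline' : HasDerivAt (fun s : ℝ => (t + s * v.1, x + s * v.2.1, y + s * v.2.2.1,
      z + s * v.2.2.2)) (v.1, v.2.1, v.2.2.1, v.2.2.2) 0 :=
    (haff _ _).prodMk ((haff _ _).prodMk ((haff _ _).prodMk (haff _ _)))
  have h := (hF.hasFDerivAt _).comp_hasDerivAt (0 : ℝ) hline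
  have h' := (hF.hasFDerivAt _).comp_hasDerivAt (0 : ℝ) hline'
  simp only [zero_mul, add_zero] at h h'
  refine h.unique (h'.congr_of_eventuallyEq (Filter.Eventually.of_forall fun s => ?_))
  simp only [Function.comp_apply]
  rw [← hF.invariant (t + s * v.1) (x + s * v.2.1) (y + s * v.2.2.1) (z + s * v.2.2.2) α ξ β γ]
  congr 1
  ext <;> simp <;> ring

theorem contDiff_fderiv_apply (hF : IsSmoothInvariant F) (v : ℝ × ℝ × ℝ × ℝ) :
    ContDiff ℝ (⊤ : ℕ∞) fun p => fderiv ℝ F p v :=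
  (hF.contDiff.fderiv_right (by simp)).clm_apply contDiff_const

theorem derivT (hF : IsSmoothInvariant F) : IsSmoothInvariant (dT F) where
  contDiff := hF.contDiff_fderiv_apply _
  invariant t x y z α ξ β γ := by
    simpa [dT, dX, dZ] using hF.fderiv_translate t x y z α ξ β γ (1, 0, 0, 0)

theorem derivX (hF : IsSmoothInvariant F) : IsSmoothInvariant (dX F) where
  contDiff := hF.contDiff_fderiv_apply _
  invariant t x y z α ξ β γ := by
    simpa [dT, dX, dZ] using hF.fderiv_translate t x y z α ξ β γ (0, 1, 0, 0)

theorem derivZ (hF : IsSmoothInvariant F) : IsSmoothInvariant (dZ F) where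
  contDiff := hF.contDiff_fderiv_apply _
  invariant t x y z α ξ β γ := by
    simpa [dT, dX, dZ] using hF.fderiv_translate t x y z α ξ β γ (0, 0, 0, 1)

/-- The invariant vector field `∂_y + x∂_z` preserves smooth invariant functions. -/
theorem derivY (hF : IsSmoothInvariant F) :
    IsSmoothInvariant fun p => dY F p + (p.2.1 : ℂ) * dZ F p where
  contDiff := (hF.contDiff_fderiv_apply _).add
    ((Complex.ofRealCLM.contDiff.comp (contDiff_fst.comp contDiff_snd)).mul
      (hF.contDiff_fderiv_apply _))
  invariant t x y z α ξ β γ := by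
    have h := hF.fderiv_translate t x y z α ξ β γ (0, 0, 1, 0)
    have h' := hF.derivZ.invariant t x y z α ξ β γ
    have e : ((0, 0, 1, 0 + (ξ : ℝ) * 1) : ℝ × ℝ × ℝ × ℝ) =
        (0, 0, 1, 0) + (ξ : ℝ) • (0, 0, 0, 1) := by ext <;> simp
    rw [e, map_add, map_smul, Complex.real_smul] at h
    simp only [dZ, dY] at h' ⊢
    rw [h'] at h ⊢
    rw [← h]
    push_cast
    ring

theorem exists_bound (hF : IsSmoothInvariant F) : ∃ C : ℝ, ∀ p, ‖F p‖ ≤ C := by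
  have hI : IsCompact (Set.Icc (0 : ℝ) 1) := isCompact_Icc
  obtain ⟨C, hC⟩ := (hI.prod (hI.prod (hI.prod hI))).exists_bound_of_continuousOn
    hF.continuous.continuousOn
  have hfract (u : ℝ) : Int.fract u ∈ Set.Icc (0 : ℝ) 1 :=
    ⟨Int.fract_nonneg u, (Int.fract_lt_one u).le⟩
  refine ⟨C, fun ⟨t, x, y, z⟩ => ?_⟩
  have h := hF.invariant t x y z (-⌊t⌋) (-⌊x⌋) (-⌊y⌋) (-⌊z - ⌊x⌋ * y⌋)
  rw [← h]
  have e : ((t + (-⌊t⌋ : ℤ), x + (-⌊x⌋ : ℤ), y + (-⌊y⌋ : ℤ),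
      z + (-⌊z - ⌊x⌋ * y⌋ : ℤ) + (-⌊x⌋ : ℤ) * y) : ℝ × ℝ × ℝ × ℝ) =
      (Int.fract t, Int.fract x, Int.fract y, Int.fract (z - ⌊x⌋ * y)) := by
    ext <;> simp only [Int.fract] <;> push_cast <;> ring
  rw [e]
  exact hC _ ⟨hfract _, hfract _, hfract _, hfract _⟩

theorem add_one_t (hF : IsSmoothInvariant F) (t x y z : ℝ) :
    F (t + 1, x, y, z) = F (t, x, y, z) := by
  simpa using hF.invariant t x y z 1 0 0 0

theorem add_one_y (hF : IsSmoothInvariant F) (t x y z : ℝ) :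
    F (t, x, y + 1, z) = F (t, x, y, z) := by
  simpa using hF.invariant t x y z 0 0 1 0

theorem add_one_z (hF : IsSmoothInvariant F) (t x y z : ℝ) :
    F (t, x, y, z + 1) = F (t, x, y, z) := by
  simpa using hF.invariant t x y z 0 0 0 1

theorem add_one_x (hF : IsSmoothInvariant F) (t x y z : ℝ) :
    F (t, x + 1, y, z) = F (t, x, y, z - y) := by
  simpa using hF.invariant t x y (z - y) 0 1 0 0

theorem hasDerivAt_t (hF : IsSmoothInvariant F) (t x y z : ℝ) :
    HasDerivAt (fun t => F (t, x, y, z)) (dT F (t, x, y, z)) t :=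
  (hF.hasFDerivAt _).comp_hasDerivAt t ((hasDerivAt_id t).prodMk (hasDerivAt_const t (x, y, z)))

theorem hasDerivAt_x (hF : IsSmoothInvariant F) (t x y z : ℝ) :
    HasDerivAt (fun x => F (t, x, y, z)) (dX F (t, x, y, z)) x :=
  (hF.hasFDerivAt _).comp_hasDerivAt x
    ((hasDerivAt_const x t).prodMk ((hasDerivAt_id x).prodMk (hasDerivAt_const x (y, z))))

theorem hasDerivAt_y (hF : IsSmoothInvariant F) (t x y z : ℝ) :
    HasDerivAt (fun y => F (t, x, y, z)) (dY F (t, x, y, z)) y :=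
  (hF.hasFDerivAt _).comp_hasDerivAt y ((hasDerivAt_const y t).prodMk
    ((hasDerivAt_const y x).prodMk ((hasDerivAt_id y).prodMk (hasDerivAt_const y z))))

theorem hasDerivAt_z (hF : IsSmoothInvariant F) (t x y z : ℝ) :
    HasDerivAt (fun z => F (t, x, y, z)) (dZ F (t, x, y, z)) z :=
  (hF.hasFDerivAt _).comp_hasDerivAt z ((hasDerivAt_const z t).prodMk
    ((hasDerivAt_const z x).prodMk ((hasDerivAt_const z y).prodMk (hasDerivAt_id z))))

end IsSmoothInvariant

/-- Fourier coefficient in `z`. -/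
noncomputable def coeffZ (n : ℤ) (F : ℝ × ℝ × ℝ × ℝ → ℂ) (t x y : ℝ) : ℂ :=
  modeCoeff n fun z => F (t, x, y, z)

/-- Fourier coefficient in `y, z`. -/
noncomputable def coeffYZ (m n : ℤ) (F : ℝ × ℝ × ℝ × ℝ → ℂ) (t x : ℝ) : ℂ :=
  modeCoeff m fun y => coeffZ n F t x y

/-- Fourier coefficient in `t, y, z`, as a function of `x`. -/
noncomputable def coeffTYZ (k m n : ℤ) (F : ℝ × ℝ × ℝ × ℝ → ℂ) (x : ℝ) : ℂ :=
  modeCoeff k fun t => coeffYZ m n F t x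

section Coefficients

variable {F G : ℝ × ℝ × ℝ × ℝ → ℂ} (k m n : ℤ)

theorem continuous_coeffZ (hF : Continuous F) :
    Continuous fun q : ℝ × ℝ × ℝ => coeffZ n F q.1 q.2.1 q.2.2 :=
  continuous_modeCoeff n (h := fun (q : ℝ × ℝ × ℝ) z => F (q.1, q.2.1, q.2.2, z))
    (hF.comp (by fun_prop))

theorem continuous_coeffYZ (hF : Continuous F) :
    Continuous fun q : ℝ × ℝ => coeffYZ m n F q.1 q.2 :=
  continuous_modeCoeff m (h := fun (q : ℝ × ℝ) y => coeffZ n F q.1 q.2 y)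
    ((continuous_coeffZ n hF).comp (g := fun q : ℝ × ℝ × ℝ => coeffZ n F q.1 q.2.1 q.2.2)
      (f := fun q : (ℝ × ℝ) × ℝ => (q.1.1, q.1.2, q.2)) (by fun_prop))

theorem continuous_coeffTYZ (hF : Continuous F) : Continuous (coeffTYZ k m n F) :=
  continuous_modeCoeff k (h := fun x t => coeffYZ m n F t x)
    ((continuous_coeffYZ m n hF).comp continuous_swap)

theorem coeffTYZ_zero (x : ℝ) : coeffTYZ k m n (fun _ => 0) x = 0 := by
  simp [coeffTYZ, coeffYZ, coeffZ, modeCoeff_zero]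

theorem coeffTYZ_add (hF : Continuous F) (hG : Continuous G) (x : ℝ) :
    coeffTYZ k m n (fun p => F p + G p) x = coeffTYZ k m n F x + coeffTYZ k m n G x := by
  have h₁ (t y : ℝ) : coeffZ n (fun p => F p + G p) t x y = coeffZ n F t x y + coeffZ n G t x y :=
    modeCoeff_add n (hF.comp (by fun_prop)) (hG.comp (by fun_prop))
  have h₂ (t : ℝ) :
      coeffYZ m n (fun p => F p + G p) t x = coeffYZ m n F t x + coeffYZ m n G t x := by
    simp only [coeffYZ, h₁]
    exact modeCoeff_add m ((continuous_coeffZ n hF).comp (f := fun y => (t, x, y)) (by fun_prop))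
      ((continuous_coeffZ n hG).comp (f := fun y => (t, x, y)) (by fun_prop))
  simp only [coeffTYZ, h₂]
  exact modeCoeff_add k ((continuous_coeffYZ m n hF).comp (f := fun t => (t, x)) (by fun_prop))
    ((continuous_coeffYZ m n hG).comp (f := fun t => (t, x)) (by fun_prop))

theorem coeffTYZ_mul_left (u : ℝ → ℂ) (F : ℝ × ℝ × ℝ × ℝ → ℂ) (x : ℝ) :
    coeffTYZ k m n (fun p => u p.2.1 * F p) x = u x * coeffTYZ k m n F x := by
  simp only [coeffTYZ, coeffYZ, coeffZ, modeCoeff_const_mul]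

theorem coeffTYZ_const_mul (c : ℂ) (F : ℝ × ℝ × ℝ × ℝ → ℂ) (x : ℝ) :
    coeffTYZ k m n (fun p => c * F p) x = c * coeffTYZ k m n F x :=
  coeffTYZ_mul_left k m n (fun _ => c) F x

end Coefficients

namespace IsSmoothInvariant

variable {F G : ℝ × ℝ × ℝ × ℝ → ℂ} (k m n : ℤ)

theorem continuous_dY (hF : IsSmoothInvariant F) : Continuous (dY F) :=
  (hF.contDiff_fderiv_apply _).continuous

theorem hasDerivAt_coeffZ_t (hF : IsSmoothInvariant F) (t x y : ℝ) :
    HasDerivAt (fun t => coeffZ n F t x y) (coeffZ n (dT F) t x y) t :=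
  hasDerivAt_modeCoeff n (h := fun t z => F (t, x, y, z)) (h' := fun t z => dT F (t, x, y, z))
    (hF.continuous.comp (by fun_prop)) (hF.derivT.continuous.comp (by fun_prop))
    (fun t z => hF.hasDerivAt_t t x y z) t

theorem hasDerivAt_coeffZ_x (hF : IsSmoothInvariant F) (t x y : ℝ) :
    HasDerivAt (fun x => coeffZ n F t x y) (coeffZ n (dX F) t x y) x :=
  hasDerivAt_modeCoeff n (h := fun x z => F (t, x, y, z)) (h' := fun x z => dX F (t, x, y, z))
    (hF.continuous.comp (by fun_prop)) (hF.derivX.continuous.comp (by fun_prop))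
    (fun x z => hF.hasDerivAt_x t x y z) x

theorem hasDerivAt_coeffZ_y (hF : IsSmoothInvariant F) (t x y : ℝ) :
    HasDerivAt (fun y => coeffZ n F t x y) (coeffZ n (dY F) t x y) y :=
  hasDerivAt_modeCoeff n (h := fun y z => F (t, x, y, z)) (h' := fun y z => dY F (t, x, y, z))
    (hF.continuous.comp (by fun_prop)) (hF.continuous_dY.comp (by fun_prop))
    (fun y z => hF.hasDerivAt_y t x y z) y

theorem hasDerivAt_coeffYZ_t (hF : IsSmoothInvariant F) (t x : ℝ) :
    HasDerivAt (fun t => coeffYZ m n F t x) (coeffYZ m n (dT F) t x) t :=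
  hasDerivAt_modeCoeff m (h := fun t y => coeffZ n F t x y)
    (h' := fun t y => coeffZ n (dT F) t x y)
    ((continuous_coeffZ n hF.continuous).comp (f := fun q : ℝ × ℝ => (q.1, x, q.2)) (by fun_prop))
    ((continuous_coeffZ n hF.derivT.continuous).comp (f := fun q : ℝ × ℝ => (q.1, x, q.2))
      (by fun_prop))
    (fun t y => hF.hasDerivAt_coeffZ_t n t x y) t

theorem hasDerivAt_coeffYZ_x (hF : IsSmoothInvariant F) (t x : ℝ) :
    HasDerivAt (fun x => coeffYZ m n F t x) (coeffYZ m n (dX F) t x) x :=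
  hasDerivAt_modeCoeff m (h := fun x y => coeffZ n F t x y)
    (h' := fun x y => coeffZ n (dX F) t x y)
    ((continuous_coeffZ n hF.continuous).comp (f := fun q : ℝ × ℝ => (t, q.1, q.2)) (by fun_prop))
    ((continuous_coeffZ n hF.derivX.continuous).comp (f := fun q : ℝ × ℝ => (t, q.1, q.2))
      (by fun_prop))
    (fun x y => hF.hasDerivAt_coeffZ_x n t x y) x

theorem hasDerivAt_coeffTYZ (hF : IsSmoothInvariant F) (x : ℝ) :
    HasDerivAt (coeffTYZ k m n F) (coeffTYZ k m n (dX F) x) x :=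
  hasDerivAt_modeCoeff k (h := fun x t => coeffYZ m n F t x)
    (h' := fun x t => coeffYZ m n (dX F) t x)
    ((continuous_coeffYZ m n hF.continuous).comp (f := fun q : ℝ × ℝ => (q.2, q.1)) (by fun_prop))
    ((continuous_coeffYZ m n hF.derivX.continuous).comp (f := fun q : ℝ × ℝ => (q.2, q.1))
      (by fun_prop))
    (fun x t => hF.hasDerivAt_coeffYZ_x m n t x) x

theorem periodic_coeffYZ_t (hF : IsSmoothInvariant F) (x : ℝ) :
    Function.Periodic (fun t => coeffYZ m n F t x) 1 := fun t => by
  simp only [coeffYZ, coeffZ, hF.add_one_t]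

theorem periodic_coeffZ_y (hF : IsSmoothInvariant F) (t x : ℝ) :
    Function.Periodic (fun y => coeffZ n F t x y) 1 := fun y => by
  simp only [coeffZ, hF.add_one_y]

theorem coeffTYZ_dT (hF : IsSmoothInvariant F) (x : ℝ) :
    coeffTYZ k m n (dT F) x = 2 * Real.pi * Complex.I * k * coeffTYZ k m n F x :=
  modeCoeff_deriv k (fun t => hF.hasDerivAt_coeffYZ_t m n t x)
    ((continuous_coeffYZ m n hF.derivT.continuous).comp (f := fun t => (t, x)) (by fun_prop))
    (by simpa using hF.periodic_coeffYZ_t m n x 0)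

theorem coeffTYZ_dY (hF : IsSmoothInvariant F) (x : ℝ) :
    coeffTYZ k m n (dY F) x = 2 * Real.pi * Complex.I * m * coeffTYZ k m n F x := by
  have h (t : ℝ) : coeffYZ m n (dY F) t x = 2 * Real.pi * Complex.I * m * coeffYZ m n F t x :=
    modeCoeff_deriv m (fun y => hF.hasDerivAt_coeffZ_y n t x y)
      ((continuous_coeffZ n hF.continuous_dY).comp (f := fun y => (t, x, y)) (by fun_prop))
      (by simpa using hF.periodic_coeffZ_y n t x 0)
  simp only [coeffTYZ, h, modeCoeff_const_mul]

theorem coeffTYZ_dZ (hF : IsSmoothInvariant F) (x : ℝ) :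
    coeffTYZ k m n (dZ F) x = 2 * Real.pi * Complex.I * n * coeffTYZ k m n F x := by
  have h (t y : ℝ) : coeffZ n (dZ F) t x y = 2 * Real.pi * Complex.I * n * coeffZ n F t x y :=
    modeCoeff_deriv n (fun z => hF.hasDerivAt_z t x y z)
      (hF.derivZ.continuous.comp (by fun_prop)) (by simpa using hF.add_one_z t x y 0)
  simp only [coeffTYZ, coeffYZ, h, modeCoeff_const_mul]

theorem coeffTYZ_derivY (hF : IsSmoothInvariant F) (x : ℝ) :
    coeffTYZ k m n (fun p => dY F p + (p.2.1 : ℂ) * dZ F p) x =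
      2 * Real.pi * Complex.I * (m + n * x) * coeffTYZ k m n F x := by
  have hc : Continuous fun p : ℝ × ℝ × ℝ × ℝ => (p.2.1 : ℂ) * dZ F p :=
    (Complex.continuous_ofReal.comp (continuous_fst.comp continuous_snd)).mul hF.derivZ.continuous
  rw [coeffTYZ_add k m n hF.continuous_dY hc, hF.coeffTYZ_dY,
    coeffTYZ_mul_left k m n (fun x => (x : ℂ)), hF.coeffTYZ_dZ]
  ring

theorem exists_bound_coeffTYZ (hF : IsSmoothInvariant F) :
    ∃ C : ℝ, ∀ x, ‖coeffTYZ k m n F x‖ ≤ C := by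
  obtain ⟨C, hC⟩ := hF.exists_bound
  exact ⟨C, fun x => norm_modeCoeff_le k fun t => norm_modeCoeff_le m fun y =>
    norm_modeCoeff_le n fun z => hC _⟩

theorem exists_mul_coeffTYZ (hF : IsSmoothInvariant F) {n : ℤ} (hn : n ≠ 0) :
    ∃ G, IsSmoothInvariant G ∧ ∀ x : ℝ, x * coeffTYZ k m n F x = coeffTYZ k m n G x := by
  have hn' : (n : ℂ) ≠ 0 := by exact_mod_cast hn
  have hG := hF.derivY.const_mul (2 * Real.pi * Complex.I * n)⁻¹
  have hH := hF.const_mul (-(m / n))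
  refine ⟨_, hG.add hH, fun x => ?_⟩
  rw [coeffTYZ_add k m n hG.continuous hH.continuous, coeffTYZ_const_mul, coeffTYZ_const_mul,
    hF.coeffTYZ_derivY]
  field_simp [Real.pi_ne_zero, Complex.I_ne_zero]
  ring

theorem rapidlyDecaying_coeffTYZ (hF : IsSmoothInvariant F) {n : ℤ} (hn : n ≠ 0) :
    RapidlyDecaying (coeffTYZ k m n F) := by
  intro j
  induction j generalizing F with
  | zero => simpa using hF.exists_bound_coeffTYZ k m n
  | succ j ih =>
    obtain ⟨G, hG, h⟩ := hF.exists_mul_coeffTYZ k m hn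
    simpa only [pow_succ, mul_assoc, h] using ih hG

theorem periodic_coeffTYZ_zero (hF : IsSmoothInvariant F) :
    Function.Periodic (coeffTYZ k m 0 F) 1 := fun x => by
  have h (t y : ℝ) : coeffZ 0 F t (x + 1) y = coeffZ 0 F t x y := by
    simp only [coeffZ, hF.add_one_x]
    exact modeCoeff_zero_comp_sub (h := fun z => F (t, x, y, z)) (hF.add_one_z t x y) y
  simp only [coeffTYZ, coeffYZ, h]

theorem eq_zero_of_coeffTYZ_eq_zero (hF : IsSmoothInvariant F)
    (h : ∀ k m n x, coeffTYZ k m n F x = 0) : F = fun _ => 0 := by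
  funext ⟨t, x, y, z⟩
  refine eq_zero_of_modeCoeff_eq_zero (h := fun z => F (t, x, y, z))
    (hF.continuous.comp (by fun_prop)) (hF.add_one_z t x y) (fun n => ?_) z
  refine eq_zero_of_modeCoeff_eq_zero (h := fun y => coeffZ n F t x y)
    ((continuous_coeffZ n hF.continuous).comp (f := fun y => (t, x, y)) (by fun_prop))
    (hF.periodic_coeffZ_y n t x) (fun m => ?_) y
  exact eq_zero_of_modeCoeff_eq_zero (h := fun t => coeffYZ m n F t x)
    ((continuous_coeffYZ m n hF.continuous).comp (f := fun t => (t, x)) (by fun_prop))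
    (hF.periodic_coeffYZ_t m n x) (fun k => h k m n x) t

end IsSmoothInvariant

section CoefficientEquations

variable {a b ρ : ℝ} {f g : ℝ × ℝ × ℝ × ℝ → ℂ}

theorem isSmoothInvariant_of_mem_solutionSet (h : (f, g) ∈ solutionSet a b ρ) :
    IsSmoothInvariant f ∧ IsSmoothInvariant g :=
  ⟨⟨h.1, h.2.2.1⟩, ⟨h.2.1, h.2.2.2.1⟩⟩

theorem coeffTYZ_first_equation (h : (f, g) ∈ solutionSet a b ρ) (k m n : ℤ) (x : ℝ) :
    -(2 * Real.pi * Complex.I * (m + n * x - (a + Complex.I) / b * n)) * coeffTYZ k m n f x +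
      (2 * Real.pi * Complex.I * k * coeffTYZ k m n g x +
        Complex.I * coeffTYZ k m n (dX g) x) + b / 2 * coeffTYZ k m n g x = 0 := by
  obtain ⟨hf, hg⟩ := isSmoothInvariant_of_mem_solutionSet h
  have h₁ := hf.derivY.const_mul (-1)
  have h₂ := hf.derivZ.const_mul ((a + Complex.I) / b)
  have h₃ := hg.derivX.const_mul Complex.I
  have h₄ := hg.const_mul (b / 2)
  have key := (coeffTYZ_add k m n (((h₁.add h₂).add hg.derivT).add h₃).continuous
    h₄.continuous x).symm
  rw [coeffTYZ_add k m n ((h₁.add h₂).add hg.derivT).continuous h₃.continuous,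
    coeffTYZ_add k m n (h₁.add h₂).continuous hg.derivT.continuous,
    coeffTYZ_add k m n h₁.continuous h₂.continuous, coeffTYZ_const_mul, coeffTYZ_const_mul,
    coeffTYZ_const_mul, coeffTYZ_const_mul, hf.coeffTYZ_derivY, hf.coeffTYZ_dZ, hg.coeffTYZ_dT,
    show (fun p => _) = fun _ => (0 : ℂ) from ?_, coeffTYZ_zero] at key
  · linear_combination key
  · funext p
    have := (h.2.2.2.2 p).1
    simp only [V₂bar, V₁bar] at this
    linear_combination 2 * this

theorem coeffTYZ_second_equation (h : (f, g) ∈ solutionSet a b ρ) (k m n : ℤ) (x : ℝ) :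
    ρ * (2 * Real.pi * Complex.I * k * coeffTYZ k m n f x -
      Complex.I * coeffTYZ k m n (dX f) x) +
      2 * Real.pi * Complex.I * (m + n * x - (a - Complex.I) / b * n) * coeffTYZ k m n g x = 0 := by
  obtain ⟨hf, hg⟩ := isSmoothInvariant_of_mem_solutionSet h
  have h₁ := hf.derivT.const_mul ρ
  have h₂ := hf.derivX.const_mul (-(ρ * Complex.I))
  have h₃ := hg.derivZ.const_mul (-((a - Complex.I) / b))
  have key := (coeffTYZ_add k m n ((h₁.add h₂).add hg.derivY).continuous h₃.continuous x).symm
  rw [coeffTYZ_add k m n (h₁.add h₂).continuous hg.derivY.continuous,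
    coeffTYZ_add k m n h₁.continuous h₂.continuous, coeffTYZ_const_mul, coeffTYZ_const_mul,
    coeffTYZ_const_mul, hf.coeffTYZ_dT, hg.coeffTYZ_derivY, hg.coeffTYZ_dZ,
    show (fun p => _) = fun _ => (0 : ℂ) from ?_, coeffTYZ_zero] at key
  · linear_combination key
  · funext p
    have := (h.2.2.2.2 p).2
    simp only [V₂, V₁] at this
    linear_combination 2 * this

end CoefficientEquations

theorem landau_resonance_ne {r : ℝ} (hr : 0 < r) (hq : ∃ q : ℚ, (q : ℝ) = r) {n : ℤ} (hn : n ≠ 0)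
    (k : ℤ) (j : ℕ) :
    (2 * Real.pi * k - 2 * Real.pi * Complex.I - Complex.I * (n / 4) / r) *
      (2 * Real.pi * k - 2 * Real.pi * Complex.I + Complex.I * (n / 4) / r) ≠
      -(2 * (|2 * Real.pi * n / r| : ℝ) * j) := by
  intro h
  have hπ := Real.pi_pos
  have h' : (((2 * Real.pi * k) ^ 2 - (2 * Real.pi) ^ 2 + (n / 4 / r) ^ 2 : ℝ) : ℂ) +
      ((-(8 * Real.pi ^ 2 * k) : ℝ) : ℂ) * Complex.I =
      ((-(2 * |2 * Real.pi * n / r| * j) : ℝ) : ℂ) + ((0 : ℝ) : ℂ) * Complex.I := by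
    push_cast
    linear_combination h - ((2 * Real.pi) ^ 2 - (n / 4 / r) ^ 2) * Complex.I_sq
  have hre := congrArg Complex.re h'
  have him := congrArg Complex.im h'
  simp only [Complex.add_re, Complex.add_im, Complex.re_ofReal_mul, Complex.im_ofReal_mul,
    Complex.ofReal_re, Complex.ofReal_im, Complex.I_re, Complex.I_im, mul_zero, mul_one, add_zero,
    zero_add] at hre him
  have hk : (k : ℝ) = 0 := by
    have : 8 * Real.pi ^ 2 * (k : ℝ) = 0 := by linarith
    simpa [hπ.ne'] using this
  obtain ⟨q, rfl⟩ := hq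
  have hq0 : 0 < q := by exact_mod_cast hr
  have hP : q.num ≠ 0 := (Rat.num_pos.mpr hq0).ne'
  have hQ : (q.den : ℝ) ≠ 0 := by exact_mod_cast q.den_ne_zero
  have hq' : (q : ℝ) = q.num / q.den := Rat.cast_def q
  have hPpos : (0 : ℝ) < q.num := by exact_mod_cast Rat.num_pos.mpr hq0
  rw [hk, abs_div, abs_mul, abs_of_pos hr, abs_of_pos (by positivity : 0 < 2 * Real.pi), hq'] at hre
  have hy : (8 * q.num * Real.pi) ^ 2 - 8 * j * |(n : ℝ)| * q.den * (8 * q.num * Real.pi) -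
      (n * q.den) ^ 2 = 0 := by
    field_simp at hre
    linear_combination -hre
  rcases Nat.eq_zero_or_pos j with rfl | hj
  · have hsq : (8 * q.num * Real.pi) ^ 2 = (n * q.den : ℝ) ^ 2 := by
      simpa [sub_eq_zero] using hy
    refine irrational_pi ?_
    rcases sq_eq_sq_iff_eq_or_eq_neg.mp hsq with h | h
    · refine ⟨n * q.den / (8 * q.num), ?_⟩
      push_cast
      rw [← h]
      field_simp
    · refine ⟨-(n * q.den) / (8 * q.num), ?_⟩
      push_cast
      rw [← h]
      field_simp
  · refine pi_not_quadratic (M := 8 * q.num) (s := 8 * j * |n| * q.den) (t := -(n * q.den) ^ 2)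
      (by simpa using hP) ?_ ?_ ?_
    · have := abs_pos.mpr hn
      have := q.den_pos
      positivity
    · simp [hn]
    · push_cast
      linear_combination hy

theorem coeffTYZ_eq_zero_of_mem_solutionSet {a ρ : ℝ} {f g : ℝ × ℝ × ℝ × ℝ → ℂ} (hρ : 0 < ρ)
    (hq : ∃ q : ℚ, (q : ℝ) = Real.sqrt ρ) (h : (f, g) ∈ solutionSet a (8 * Real.pi) ρ)
    (k m : ℤ) {n : ℤ} (hn : n ≠ 0) (x : ℝ) :
    coeffTYZ k m n f x = 0 ∧ coeffTYZ k m n g x = 0 := by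
  obtain ⟨hf, hg⟩ := isSmoothInvariant_of_mem_solutionSet h
  have hr : 0 < Real.sqrt ρ := Real.sqrt_pos.mpr hρ
  have hres := landau_resonance_ne hr hq hn k
  set r := Real.sqrt ρ
  have hρr : (ρ : ℂ) = r ^ 2 := by exact_mod_cast (Real.sq_sqrt hρ.le).symm
  have hr' : (r : ℂ) ≠ 0 := by exact_mod_cast hr.ne'
  have hπ : (Real.pi : ℂ) ≠ 0 := by exact_mod_cast Real.pi_ne_zero
  have hn' : (n : ℝ) ≠ 0 := by exact_mod_cast hn
  have hφ := hf.rapidlyDecaying_coeffTYZ k m hn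
  have hγ := hg.rapidlyDecaying_coeffTYZ k m hn
  have hdφ := hf.hasDerivAt_coeffTYZ k m n
  have hdγ := hg.hasDerivAt_coeffTYZ k m n
  have e₁ := coeffTYZ_first_equation h k m n
  have e₂ := coeffTYZ_second_equation h k m n
  generalize coeffTYZ k m n (dX f) = φ' at *
  generalize coeffTYZ k m n (dX g) = γ' at *
  generalize coeffTYZ k m n f = φ at *
  generalize coeffTYZ k m n g = γ at *
  push_cast at e₁ e₂
  have e₁' (x : ℝ) : γ' x = (2 * Real.pi * (m + n * x - a * n / (8 * Real.pi)) -
      Complex.I * (n / 4)) * φ x - (2 * Real.pi * k - 4 * Real.pi * Complex.I) * γ x := by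
    have := e₁ x
    field_simp at this ⊢
    linear_combination (-2 * Complex.I) * this + 4 * (-(2 * (Real.pi * (m + n * x) * 8 -
      n * (a + Complex.I)) * φ x) + 8 * (2 * Real.pi * k * γ x + γ' x)) * Complex.I_sq
  have e₂' (x : ℝ) : φ' x = 2 * Real.pi * k * φ x +
      (2 * Real.pi * (m + n * x - a * n / (8 * Real.pi)) + Complex.I * (n / 4)) / r ^ 2 * γ x := by
    have := e₂ x
    rw [hρr] at this
    field_simp at this ⊢
    linear_combination (4 * Complex.I) * this - 4 * (r ^ 2 * (2 * Real.pi * k * φ x - φ' x) * 8 +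
      2 * (Real.pi * (m + n * x) * 8 - n * (a - Complex.I)) * γ x) * Complex.I_sq
  have hp := (hφ.const_mul r).add hγ |>.mul_of_norm_eq_one (norm_expMode (-1))
  have hq := (hφ.const_mul r).add (hγ.const_mul (-1)) |>.mul_of_norm_eq_one (norm_expMode (-1))
  obtain ⟨hp0, hq0⟩ := eq_zero_of_oscillator (w := 2 * Real.pi * n / r)
    (v := 2 * Real.pi * (m - a * n / (8 * Real.pi)) / r) (by positivity) hp hq hres
    (fun x => by
      refine ((hasDerivAt_expMode (-1) x).mul
        (((hdφ x).const_mul (r : ℂ)).add (hdγ x))).congr_deriv ?_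
      rw [Pi.add_apply, e₁', e₂']
      push_cast
      field_simp
      ring)
    (fun x => by
      refine ((hasDerivAt_expMode (-1) x).mul
        (((hdφ x).const_mul (r : ℂ)).add ((hdγ x).const_mul (-1)))).congr_deriv ?_
      rw [Pi.add_apply, e₁', e₂']
      push_cast
      field_simp
      ring) x
  have hp1 := (mul_eq_zero.mp hp0).resolve_left (expMode_ne_zero _ _)
  have hq1 := (mul_eq_zero.mp hq0).resolve_left (expMode_ne_zero _ _)
  exact ⟨(mul_eq_zero.mp (by linear_combination (hp1 + hq1) / 2)).resolve_left hr',
    by linear_combination (hp1 - hq1) / 2⟩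

theorem modeCoeff_linear_eq_zero (l : ℤ) {c₁ c₂ c₃ : ℂ} {h₁ h₂ h₃ : ℝ → ℂ} (hc₁ : Continuous h₁)
    (hc₂ : Continuous h₂) (hc₃ : Continuous h₃)
    (h : ∀ x, c₁ * h₁ x + c₂ * h₂ x + c₃ * h₃ x = 0) :
    c₁ * modeCoeff l h₁ + c₂ * modeCoeff l h₂ + c₃ * modeCoeff l h₃ = 0 := by
  rw [← modeCoeff_const_mul, ← modeCoeff_const_mul, ← modeCoeff_const_mul,
    ← modeCoeff_add l (by fun_prop) (by fun_prop), ← modeCoeff_add l (by fun_prop) (by fun_prop),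
    funext h, modeCoeff_zero]

/-- The Fourier coefficient of frequency `(k, l, m, 0)`. -/
noncomputable def torusCoeff (k l m : ℤ) (F : ℝ × ℝ × ℝ × ℝ → ℂ) : ℂ :=
  modeCoeff l (coeffTYZ k m 0 F)

namespace IsSmoothInvariant

variable {F G : ℝ × ℝ × ℝ × ℝ → ℂ} (k l m : ℤ)

theorem torusCoeff_add (hF : IsSmoothInvariant F) (hG : IsSmoothInvariant G) :
    torusCoeff k l m (F + G) = torusCoeff k l m F + torusCoeff k l m G := by
  have h : coeffTYZ k m 0 (F + G) = fun x => coeffTYZ k m 0 F x + coeffTYZ k m 0 G x :=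
    funext fun x => coeffTYZ_add k m 0 hF.continuous hG.continuous x
  rw [torusCoeff, h]
  exact modeCoeff_add l (continuous_coeffTYZ k m 0 hF.continuous)
    (continuous_coeffTYZ k m 0 hG.continuous)

theorem torusCoeff_dX (hF : IsSmoothInvariant F) :
    torusCoeff k l m (dX F) = 2 * Real.pi * Complex.I * l * torusCoeff k l m F :=
  modeCoeff_deriv l (fun x => hF.hasDerivAt_coeffTYZ k m 0 x)
    (continuous_coeffTYZ k m 0 hF.derivX.continuous)
    (by simpa using hF.periodic_coeffTYZ_zero k m 0)

end IsSmoothInvariant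

theorem torusCoeff_const_mul (k l m : ℤ) (c : ℂ) (F : ℝ × ℝ × ℝ × ℝ → ℂ) :
    torusCoeff k l m (fun p => c * F p) = c * torusCoeff k l m F := by
  rw [torusCoeff, funext (coeffTYZ_const_mul k m 0 c F), modeCoeff_const_mul, torusCoeff]

section TorusEquations

variable {a ρ : ℝ} {f g : ℝ × ℝ × ℝ × ℝ → ℂ}

theorem torusCoeff_equations (h : (f, g) ∈ solutionSet a (8 * Real.pi) ρ) (k l m : ℤ) :
    Complex.I * m * torusCoeff k l m f = (Complex.I * k - l + 2) * torusCoeff k l m g ∧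
      ρ * (Complex.I * k + l) * torusCoeff k l m f + Complex.I * m * torusCoeff k l m g = 0 := by
  obtain ⟨hf, hg⟩ := isSmoothInvariant_of_mem_solutionSet h
  have hπ : (Real.pi : ℂ) ≠ 0 := by exact_mod_cast Real.pi_ne_zero
  have hφ := continuous_coeffTYZ k m 0 hf.continuous
  have hγ := continuous_coeffTYZ k m 0 hg.continuous
  have e₁ := modeCoeff_linear_eq_zero l (c₁ := -(2 * Real.pi * Complex.I * m)) (c₂ := Complex.I)
    (c₃ := 2 * Real.pi * Complex.I * k + 4 * Real.pi) hφ
    (continuous_coeffTYZ k m 0 hg.derivX.continuous) hγ fun x => by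
      have := coeffTYZ_first_equation h k m 0 x
      push_cast at this
      linear_combination this
  have e₂ := modeCoeff_linear_eq_zero l (c₁ := ρ * (2 * Real.pi * Complex.I * k))
    (c₂ := -(ρ * Complex.I)) (c₃ := 2 * Real.pi * Complex.I * m) hφ
    (continuous_coeffTYZ k m 0 hf.derivX.continuous) hγ fun x => by
      have := coeffTYZ_second_equation h k m 0 x
      push_cast at this
      linear_combination this
  rw [← torusCoeff, ← torusCoeff, ← torusCoeff, hg.torusCoeff_dX] at e₁
  rw [← torusCoeff, ← torusCoeff, ← torusCoeff, hf.torusCoeff_dX] at e₂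
  have h2π : (2 * Real.pi : ℂ) ≠ 0 := mul_ne_zero two_ne_zero hπ
  constructor <;> apply mul_left_cancel₀ h2π
  · linear_combination -e₁ + 2 * Real.pi * l * torusCoeff k l m g * Complex.I_sq
  · linear_combination e₂ + 2 * Real.pi * ρ * l * torusCoeff k l m f * Complex.I_sq

/-- Frequencies other than `k = 0`, `m ^ 2 = ρ * l * (2 - l)` do not occur in a solution. -/
theorem torusCoeff_eq_zero (h : (f, g) ∈ solutionSet a (8 * Real.pi) ρ) (hρ : 0 < ρ) {k l m : ℤ}
    (hklm : k = 0 → (m : ℝ) ^ 2 ≠ ρ * (l * (2 - l))) :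
    torusCoeff k l m f = 0 ∧ torusCoeff k l m g = 0 := by
  obtain ⟨e₁, e₂⟩ := torusCoeff_equations h k l m
  have hdet : (((m : ℝ) ^ 2 + ρ * (k ^ 2 + l ^ 2 - 2 * l) : ℝ) : ℂ) +
      ((-(2 * ρ * k) : ℝ) : ℂ) * Complex.I ≠ 0 := by
    intro h0
    have hre := congrArg Complex.re h0
    have him := congrArg Complex.im h0
    simp only [Complex.add_re, Complex.add_im, Complex.re_ofReal_mul, Complex.im_ofReal_mul,
      Complex.ofReal_re, Complex.ofReal_im, Complex.I_re, Complex.I_im, mul_zero, mul_one, add_zero,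
      zero_add, Complex.zero_re, Complex.zero_im] at hre him
    have hk : (k : ℝ) = 0 := by simpa [hρ.ne'] using him
    refine hklm (by exact_mod_cast hk) ?_
    rw [hk] at hre
    linear_combination hre
  push_cast at hdet
  constructor <;> refine (mul_eq_zero.mp ?_).resolve_left hdet
  · linear_combination -Complex.I * m * e₁ - (2 + Complex.I * k - l) * e₂ +
      (m ^ 2 + ρ * k ^ 2) * torusCoeff k l m f * Complex.I_sq
  · linear_combination ρ * (Complex.I * k + l) * e₁ - Complex.I * m * e₂ +
      (m ^ 2 + ρ * k ^ 2) * torusCoeff k l m g * Complex.I_sq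

theorem eq_zero_of_torusCoeff_eq_zero (h : (f, g) ∈ solutionSet a (8 * Real.pi) ρ) (hρ : 0 < ρ)
    (hq : ∃ q : ℚ, (q : ℝ) = Real.sqrt ρ)
    (h0 : ∀ l m : ℤ, (m : ℝ) ^ 2 = ρ * (l * (2 - l)) →
      torusCoeff 0 l m (if l = 2 then g else f) = 0) :
    f = (fun _ => 0) ∧ g = fun _ => 0 := by
  obtain ⟨hf, hg⟩ := isSmoothInvariant_of_mem_solutionSet h
  have htorus (k l m : ℤ) : torusCoeff k l m f = 0 ∧ torusCoeff k l m g = 0 := by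
    by_cases hklm : k = 0 → (m : ℝ) ^ 2 ≠ ρ * (l * (2 - l))
    · exact torusCoeff_eq_zero h hρ hklm
    push Not at hklm
    obtain ⟨rfl, hm⟩ := hklm
    obtain ⟨e₁, e₂⟩ := torusCoeff_equations h 0 l m
    have hz := h0 l m hm
    split_ifs at hz with hl
    · subst hl
      have hρ' : (ρ : ℂ) ≠ 0 := by exact_mod_cast hρ.ne'
      simpa [hz, hρ'] using e₂
    · have hl' : (-l + 2 : ℂ) ≠ 0 := by
        intro h2
        exact hl (by exact_mod_cast (by linear_combination -h2 : (l : ℂ) = 2))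
      simpa [hz, hl'] using e₁
  have hcoeff (k m n : ℤ) (x : ℝ) : coeffTYZ k m n f x = 0 ∧ coeffTYZ k m n g x = 0 := by
    rcases eq_or_ne n 0 with rfl | hn
    · exact ⟨eq_zero_of_modeCoeff_eq_zero (continuous_coeffTYZ k m 0 hf.continuous)
          (hf.periodic_coeffTYZ_zero k m) (fun l => (htorus k l m).1) x,
        eq_zero_of_modeCoeff_eq_zero (continuous_coeffTYZ k m 0 hg.continuous)
          (hg.periodic_coeffTYZ_zero k m) (fun l => (htorus k l m).2) x⟩
    · exact coeffTYZ_eq_zero_of_mem_solutionSet hρ hq h k m hn x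
  exact ⟨hf.eq_zero_of_coeffTYZ_eq_zero fun k m n x => (hcoeff k m n x).1,
    hg.eq_zero_of_coeffTYZ_eq_zero fun k m n x => (hcoeff k m n x).2⟩

end TorusEquations

namespace IsSmoothInvariant

variable {F G : ℝ × ℝ × ℝ × ℝ → ℂ}

theorem fderiv_add (hF : IsSmoothInvariant F) (hG : IsSmoothInvariant G) (p : ℝ × ℝ × ℝ × ℝ) :
    fderiv ℝ (F + G) p = fderiv ℝ F p + fderiv ℝ G p :=
  ((hF.hasFDerivAt p).add (hG.hasFDerivAt p)).fderiv

theorem fderiv_const_smul (hF : IsSmoothInvariant F) (c : ℂ) (p : ℝ × ℝ × ℝ × ℝ) :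
    fderiv ℝ (c • F) p = c • fderiv ℝ F p :=
  ((hF.hasFDerivAt p).const_smul c).fderiv

end IsSmoothInvariant

/-- The complex vector space of solutions. -/
def solutionSubmodule (a b ρ : ℝ) :
    Submodule ℂ (((ℝ × ℝ × ℝ × ℝ) → ℂ) × ((ℝ × ℝ × ℝ × ℝ) → ℂ)) where
  carrier := solutionSet a b ρ
  zero_mem' := by
    refine ⟨contDiff_const, contDiff_const, fun _ _ _ _ _ _ _ _ => rfl,
      fun _ _ _ _ _ _ _ _ => rfl, fun q => ?_⟩
    simp [V₁, V₂, V₁bar, V₂bar, dT, dX, dY, dZ]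
  add_mem' := by
    rintro ⟨f, g⟩ ⟨f', g'⟩ h h'
    obtain ⟨hf, hg⟩ := isSmoothInvariant_of_mem_solutionSet h
    obtain ⟨hf', hg'⟩ := isSmoothInvariant_of_mem_solutionSet h'
    refine ⟨hf.contDiff.add hf'.contDiff, hg.contDiff.add hg'.contDiff, (hf.add hf').invariant,
      (hg.add hg').invariant, fun q => ?_⟩
    obtain ⟨e₁, e₂⟩ := h.2.2.2.2 q
    obtain ⟨e₁', e₂'⟩ := h'.2.2.2.2 q
    simp only [V₁, V₂, V₁bar, V₂bar, dT, dX, dY, dZ] at e₁ e₂ e₁' e₂'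
    simp only [V₁, V₂, V₁bar, V₂bar, dT, dX, dY, dZ, Prod.mk_add_mk, hf.fderiv_add hf',
      hg.fderiv_add hg', add_apply, Pi.add_apply]
    exact ⟨by linear_combination e₁ + e₁', by linear_combination e₂ + e₂'⟩
  smul_mem' := by
    rintro c ⟨f, g⟩ h
    obtain ⟨hf, hg⟩ := isSmoothInvariant_of_mem_solutionSet h
    refine ⟨contDiff_const.mul hf.contDiff, contDiff_const.mul hg.contDiff,
      (hf.const_mul c).invariant, (hg.const_mul c).invariant, fun q => ?_⟩
    obtain ⟨e₁, e₂⟩ := h.2.2.2.2 q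
    simp only [V₁, V₂, V₁bar, V₂bar, dT, dX, dY, dZ] at e₁ e₂
    simp only [V₁, V₂, V₁bar, V₂bar, dT, dX, dY, dZ, Prod.smul_mk, hf.fderiv_const_smul,
      hg.fderiv_const_smul, smul_apply, Pi.smul_apply, smul_eq_mul]
    exact ⟨by linear_combination c * e₁, by linear_combination c * e₂⟩

section TorusModes

/-- The function `exp (2πi(lx + my))`. -/
noncomputable def torusMode (l m : ℤ) (p : ℝ × ℝ × ℝ × ℝ) : ℂ :=
  expMode l p.2.1 * expMode m p.2.2.1

variable (l m : ℤ)

theorem contDiff_expMode (k : ℤ) : ContDiff ℝ (⊤ : ℕ∞) (expMode k) :=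
  (contDiff_const.mul Complex.ofRealCLM.contDiff).cexp

theorem isSmoothInvariant_torusMode : IsSmoothInvariant (torusMode l m) where
  contDiff := ((contDiff_expMode l).comp (contDiff_fst.comp contDiff_snd)).mul
    ((contDiff_expMode m).comp (contDiff_fst.comp (contDiff_snd.comp contDiff_snd)))
  invariant t x y z α ξ β γ := by simp only [torusMode, expMode_add_intCast]

theorem dT_torusMode (p : ℝ × ℝ × ℝ × ℝ) : dT (torusMode l m) p = 0 :=
  ((isSmoothInvariant_torusMode l m).hasDerivAt_t p.1 p.2.1 p.2.2.1 p.2.2.2).unique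
    (hasDerivAt_const _ (expMode l p.2.1 * expMode m p.2.2.1))

theorem dX_torusMode (p : ℝ × ℝ × ℝ × ℝ) :
    dX (torusMode l m) p = 2 * Real.pi * Complex.I * l * torusMode l m p := by
  have h := ((isSmoothInvariant_torusMode l m).hasDerivAt_x p.1 p.2.1 p.2.2.1 p.2.2.2).unique
    ((hasDerivAt_expMode l p.2.1).mul_const (expMode m p.2.2.1))
  exact h.trans (mul_assoc _ _ _)

theorem dY_torusMode (p : ℝ × ℝ × ℝ × ℝ) :
    dY (torusMode l m) p = 2 * Real.pi * Complex.I * m * torusMode l m p := by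
  have h := ((isSmoothInvariant_torusMode l m).hasDerivAt_y p.1 p.2.1 p.2.2.1 p.2.2.2).unique
    ((hasDerivAt_expMode m p.2.2.1).const_mul (expMode l p.2.1))
  exact h.trans (mul_left_comm _ _ _)

theorem dZ_torusMode (p : ℝ × ℝ × ℝ × ℝ) : dZ (torusMode l m) p = 0 :=
  ((isSmoothInvariant_torusMode l m).hasDerivAt_z p.1 p.2.1 p.2.2.1 p.2.2.2).unique
    (hasDerivAt_const _ (expMode l p.2.1 * expMode m p.2.2.1))

theorem torusCoeff_torusMode (l' m' : ℤ) :
    torusCoeff 0 l' m' (torusMode l m) = if (l, m) = (l', m') then 1 else 0 := by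
  have hconst (c : ℂ) : modeCoeff 0 (fun _ => c) = c := by simp [modeCoeff, expMode]
  have h : coeffTYZ 0 m' 0 (torusMode l m) =
      fun x => (if m = m' then 1 else 0) * expMode l x := by
    funext x
    simp only [coeffTYZ, coeffYZ, coeffZ, torusMode, hconst, modeCoeff_const_mul,
      modeCoeff_expMode]
    rw [mul_comm]
  rw [torusCoeff, h, modeCoeff_const_mul, modeCoeff_expMode]
  simp only [Prod.mk.injEq]
  split_ifs <;> simp_all

/-- The `f`-component of the solution of frequency `(l, m)`. -/
noncomputable def modeFst : ℂ := if l = 2 then 0 else 1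

/-- The `g`-component of the solution of frequency `(l, m)`. -/
noncomputable def modeSnd : ℂ := if l = 2 then 1 else Complex.I * m / (2 - l)

theorem torusMode_mem_solutionSubmodule (a : ℝ) {ρ : ℝ} {l m : ℤ}
    (hlm : (m : ℝ) ^ 2 = ρ * (l * (2 - l))) :
    (modeFst l • torusMode l m, modeSnd l m • torusMode l m) ∈
      solutionSubmodule a (8 * Real.pi) ρ := by
  have hE := isSmoothInvariant_torusMode l m
  have hlm' : (m : ℂ) ^ 2 = ρ * (l * (2 - l)) := by exact_mod_cast hlm
  have h₁ : Complex.I * m * modeFst l = (2 - l) * modeSnd l m := by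
    unfold modeFst modeSnd
    split_ifs with hl
    · simp [hl]
    · have : (2 - l : ℂ) ≠ 0 := sub_ne_zero.mpr fun h => hl (by exact_mod_cast h.symm)
      field_simp
  have h₂ : ρ * l * modeFst l + Complex.I * m * modeSnd l m = 0 := by
    unfold modeFst modeSnd
    split_ifs with hl
    · have : m = 0 := by simpa [hl] using hlm
      simp [this]
    · have : (2 - l : ℂ) ≠ 0 := sub_ne_zero.mpr fun h => hl (by exact_mod_cast h.symm)
      field_simp
      linear_combination m ^ 2 * Complex.I_sq - hlm'
  refine ⟨contDiff_const.mul hE.contDiff, contDiff_const.mul hE.contDiff,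
    (hE.const_mul _).invariant, (hE.const_mul _).invariant, fun q => ?_⟩
  have hT := dT_torusMode l m q
  have hX := dX_torusMode l m q
  have hY := dY_torusMode l m q
  have hZ := dZ_torusMode l m q
  simp only [dT, dX, dY, dZ] at hT hX hY hZ
  simp only [V₁, V₂, V₁bar, V₂bar, dT, dX, dY, dZ, hE.fderiv_const_smul, smul_apply,
    Pi.smul_apply, smul_eq_mul, hT, hX, hY, hZ]
  push_cast
  constructor
  · linear_combination -Real.pi * torusMode l m q * h₁ +
      Real.pi * l * modeSnd l m * torusMode l m q * Complex.I_sq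
  · linear_combination Real.pi * torusMode l m q * h₂ -
      Real.pi * ρ * l * modeFst l * torusMode l m q * Complex.I_sq

end TorusModes

/-- The Fourier coefficient of a solution that determines its component of frequency `(l, m)`. -/
noncomputable def solutionCoeff (a ρ : ℝ) (i : ℤ × ℤ) :
    solutionSubmodule a (8 * Real.pi) ρ →ₗ[ℂ] ℂ where
  toFun u := torusCoeff 0 i.1 i.2 (if i.1 = 2 then u.1.2 else u.1.1)
  map_add' u v := by
    obtain ⟨hu₁, hu₂⟩ := isSmoothInvariant_of_mem_solutionSet u.2
    obtain ⟨hv₁, hv₂⟩ := isSmoothInvariant_of_mem_solutionSet v.2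
    split_ifs
    · exact hu₂.torusCoeff_add _ _ _ hv₂
    · exact hu₁.torusCoeff_add _ _ _ hv₁
  map_smul' c u := by
    split_ifs <;> exact torusCoeff_const_mul _ _ _ _ _

theorem rank_span_solutionSet (a : ℝ) {ρ : ℝ} (hρ : 0 < ρ) (hq : ∃ q : ℚ, (q : ℝ) = Real.sqrt ρ)
    (s : Finset (ℤ × ℤ)) (hs : ∀ i, i ∈ s ↔ (i.2 : ℝ) ^ 2 = ρ * (i.1 * (2 - i.1))) :
    Module.rank ℂ (Submodule.span ℂ (solutionSet a (8 * Real.pi) ρ)) = s.card := by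
  rw [show Submodule.span ℂ (solutionSet a (8 * Real.pi) ρ) = solutionSubmodule a (8 * Real.pi) ρ
    from Submodule.span_eq (solutionSubmodule a (8 * Real.pi) ρ)]
  let Φ : solutionSubmodule a (8 * Real.pi) ρ →ₗ[ℂ] (s → ℂ) :=
    LinearMap.pi fun i => solutionCoeff a ρ i
  have hinj : Function.Injective Φ := by
    rw [injective_iff_map_eq_zero]
    rintro ⟨⟨f, g⟩, h⟩ h0
    obtain ⟨hf, hg⟩ := eq_zero_of_torusCoeff_eq_zero h hρ hq fun l m hlm =>
      congrFun h0 ⟨(l, m), (hs _).mpr hlm⟩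
    exact Subtype.ext (Prod.ext hf hg)
  let Ψ : (s → ℂ) →ₗ[ℂ] solutionSubmodule a (8 * Real.pi) ρ :=
    (Pi.basisFun ℂ s).constr ℂ fun i => ⟨_, torusMode_mem_solutionSubmodule a ((hs _).mp i.2)⟩
  have hΦΨ : Φ ∘ₗ Ψ = LinearMap.id := by
    refine (Pi.basisFun ℂ s).ext fun i => funext fun j => ?_
    rw [LinearMap.comp_apply, Module.Basis.constr_basis, LinearMap.id_apply, Pi.basisFun_apply,
      Pi.single_apply]
    have hcoeff (c : ℂ) : torusCoeff 0 j.1.1 j.1.2 (c • torusMode i.1.1 i.1.2) =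
        c * if j = i then 1 else 0 := by
      have h := torusCoeff_torusMode i.1.1 i.1.2 j.1.1 j.1.2
      simp only [Prod.mk.eta, Subtype.coe_inj, eq_comm (a := i)] at h
      rw [← h]
      exact torusCoeff_const_mul _ _ _ _ _
    change torusCoeff 0 j.1.1 j.1.2 (if j.1.1 = 2 then _ else _) = _
    rw [apply_ite (torusCoeff 0 j.1.1 j.1.2), hcoeff, hcoeff]
    split_ifs with h2 hji hji
    · simp [modeSnd, ← hji, h2]
    · simp
    · simp [modeFst, ← hji, h2]
    · simp
  have hsurj : Function.Surjective Φ := fun c => ⟨Ψ c, LinearMap.congr_fun hΦΨ c⟩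
  rw [(LinearEquiv.ofBijective Φ ⟨hinj, hsurj⟩).rank_eq, rank_fun', Fintype.card_coe]

/-- For `b = 8π` and `√ρ ∈ ℚ`, the solution space of the
`∂̄`-harmonic `(0,1)`-form equations has complex dimension `4` if `√ρ ∈ ℤ` and `2` if
`√ρ ∈ ℚ \ ℤ`; in particular the dimension is not independent of `ρ`. -/
theorem stmt17 (a ρ : ℝ) (hρ : 0 < ρ) (hq : ∃ q : ℚ, (q : ℝ) = Real.sqrt ρ) :
    ((∃ r : ℤ, (r : ℝ) = Real.sqrt ρ) →
      Module.rank ℂ ↥(Submodule.span ℂ (solutionSet a (8 * Real.pi) ρ)) = 4) ∧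
    ((¬ ∃ r : ℤ, (r : ℝ) = Real.sqrt ρ) →
      Module.rank ℂ ↥(Submodule.span ℂ (solutionSet a (8 * Real.pi) ρ)) = 2) := by
  have hr : 0 < Real.sqrt ρ := Real.sqrt_pos.mpr hρ
  have hr2 : Real.sqrt ρ ^ 2 = ρ := Real.sq_sqrt hρ.le
  have hl (l m : ℤ) (h : (m : ℝ) ^ 2 = ρ * (l * (2 - l))) : l = 0 ∨ l = 1 ∨ l = 2 := by
    have h1 : (0 : ℝ) ≤ ((l * (2 - l) : ℤ) : ℝ) := by
      push_cast
      exact nonneg_of_mul_nonneg_right (h ▸ sq_nonneg _) hρ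
    have h2 : 0 ≤ l * (2 - l) := by exact_mod_cast h1
    have : 0 ≤ l := by nlinarith
    have : l ≤ 2 := by nlinarith
    omega
  constructor
  · rintro ⟨r, hr'⟩
    have hr0 : r ≠ 0 := by
      rintro rfl
      simp [← hr'] at hr
    have hrr : r ≠ -r := by omega
    rw [rank_span_solutionSet a hρ hq {(0, 0), (2, 0), (1, r), (1, -r)}]
    · simp [hrr]
    · rintro ⟨l, m⟩
      simp only [Finset.mem_insert, Finset.mem_singleton, Prod.mk.injEq]
      constructor
      · rintro (⟨rfl, rfl⟩ | ⟨rfl, rfl⟩ | ⟨rfl, rfl⟩ | ⟨rfl, rfl⟩) <;> push_cast <;>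
          linarith [hr' ▸ hr2]
      · intro h
        rcases hl l m h with rfl | rfl | rfl
        · simpa using h
        · have : (m : ℝ) ^ 2 = (r : ℝ) ^ 2 := by
            rw [hr', hr2, h]
            push_cast
            ring
          have : m = r ∨ m = -r := sq_eq_sq_iff_eq_or_eq_neg.mp (by exact_mod_cast this)
          simpa using this
        · simpa using h
  · intro hr'
    rw [rank_span_solutionSet a hρ hq {(0, 0), (2, 0)}]
    · simp
    · rintro ⟨l, m⟩
      simp only [Finset.mem_insert, Finset.mem_singleton, Prod.mk.injEq]
      constructor
      · rintro (⟨rfl, rfl⟩ | ⟨rfl, rfl⟩) <;> simp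
      · intro h
        rcases hl l m h with rfl | rfl | rfl
        · simpa using h
        · refine absurd ⟨|m|, ?_⟩ hr'
          rw [Int.cast_abs, ← Real.sqrt_sq_eq_abs, h]
          norm_num
        · simpa using h
end

section
/- Fix a ∈ ℝ, b ∈ ℝ\{0}, and ρ > 0, and assume that b²√ρ/(8π) is transcendental (not an algebraic number). Then the complex vector space of pairs (f, g) of smooth Γ-invariant functions ℝ⁴ → ℂ satisfying −V̄₂(f) + V̄₁(g) + (b/4)·g = 0 and ρ·V₁(f) + V₂(g) = 0 everywhere on ℝ⁴ has complex dimension equal to the (finite) number of pairs (l, m) ∈ ℤ² with m² + ρl² − (bρ/4π)·l = 0. -/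
open MeasureTheory in
theorem hasFDerivAt_intervalIntegral_param {V E : Type} [NormedAddCommGroup V] [NormedSpace ℝ V]
    [FiniteDimensional ℝ V] [NormedAddCommGroup E] [NormedSpace ℝ E] [CompleteSpace E]
    {H : V × ℝ → E} (hH : ContDiff ℝ 1 H) (v : V) :
    HasFDerivAt (fun v => ∫ s in (0 : ℝ)..1, H (v, s))
      (∫ s in (0 : ℝ)..1, (fderiv ℝ H (v, s)).comp (ContinuousLinearMap.inl ℝ V ℝ)) v := by
  have hc : Continuous fun p : V × ℝ =>
      (fderiv ℝ H p).comp (ContinuousLinearMap.inl ℝ V ℝ) :=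
    (hH.continuous_fderiv one_ne_zero).clm_comp continuous_const
  obtain ⟨C, hC⟩ := ((isCompact_closedBall v 1).prod (isCompact_Icc (a := (0 : ℝ)) (b := 1))
    ).exists_bound_of_continuousOn hc.continuousOn
  refine intervalIntegral.hasFDerivAt_integral_of_dominated_of_fderiv_le
    (F' := fun v s => (fderiv ℝ H (v, s)).comp (ContinuousLinearMap.inl ℝ V ℝ))
    (bound := fun _ => C) (Metric.closedBall_mem_nhds v one_pos) ?_ ?_ ?_ ?_ ?_ ?_
  · exact Filter.Eventually.of_forall fun w =>
      (hH.continuous.comp (Continuous.prodMk_right w)).aestronglyMeasurable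
  · exact (hH.continuous.comp (Continuous.prodMk_right v)).intervalIntegrable _ _
  · exact (hc.comp (Continuous.prodMk_right v)).aestronglyMeasurable
  · refine Filter.Eventually.of_forall fun s hs w hw => hC (w, s) ⟨hw, ?_⟩
    rw [Set.uIoc_of_le zero_le_one] at hs
    exact Set.Ioc_subset_Icc_self hs
  · exact intervalIntegrable_const
  · refine Filter.Eventually.of_forall fun s _ w _ => ?_
    have := (hH.differentiable one_ne_zero (w, s)).hasFDerivAt
    exact this.comp w (hasFDerivAt_prodMk_left w s)

theorem contDiff_intervalIntegral_param_nat {V : Type} [NormedAddCommGroup V] [NormedSpace ℝ V]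
    [FiniteDimensional ℝ V] (n : ℕ) : ∀ {E : Type} [NormedAddCommGroup E] [NormedSpace ℝ E]
    [CompleteSpace E] {H : V × ℝ → E}, ContDiff ℝ (⊤ : ℕ∞) H →
    ContDiff ℝ n (fun v => ∫ s in (0 : ℝ)..1, H (v, s)) := by
  induction n with
  | zero =>
    intro E _ _ _ H hH
    refine contDiff_zero.2 (continuous_iff_continuousAt.2 fun v => ?_)
    exact (hasFDerivAt_intervalIntegral_param (hH.of_le (by simp)) v).continuousAt
  | succ n ih =>
    intro E _ _ _ H hH
    have h1 : ContDiff ℝ 1 H := hH.of_le (by simp)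
    refine contDiff_succ_iff_hasFDerivAt.2 ⟨_, ?_, hasFDerivAt_intervalIntegral_param h1⟩
    have h2 : ContDiff ℝ (⊤ : ℕ∞) (fderiv ℝ H) := hH.fderiv_right (by simp)
    exact ih (H := fun p => (fderiv ℝ H p).comp (ContinuousLinearMap.inl ℝ V ℝ))
      (h2.clm_comp contDiff_const)

theorem contDiff_intervalIntegral_param {V : Type} [NormedAddCommGroup V] [NormedSpace ℝ V]
    [FiniteDimensional ℝ V] {E : Type} [NormedAddCommGroup E] [NormedSpace ℝ E]
    [CompleteSpace E] {H : V × ℝ → E} (hH : ContDiff ℝ (⊤ : ℕ∞) H) :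
    ContDiff ℝ (⊤ : ℕ∞) (fun v => ∫ s in (0 : ℝ)..1, H (v, s)) :=
  contDiff_infty.2 fun n => contDiff_intervalIntegral_param_nat n hH

/-- The character `s ↦ exp (2πi n s)` of `ℝ / ℤ`, as a function on `ℝ`. -/
noncomputable def echar (n : ℤ) (s : ℝ) : ℂ := Complex.exp (2 * Real.pi * Complex.I * n * s)

theorem echar_add (n : ℤ) (s t : ℝ) : echar n (s + t) = echar n s * echar n t := by
  simp only [echar, ← Complex.exp_add]; push_cast; ring_nf

theorem echar_int (n k : ℤ) : echar n k = 1 := by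
  rw [echar, Complex.exp_eq_one_iff]
  exact ⟨n * k, by push_cast; ring⟩

theorem echar_zero_left (s : ℝ) : echar 0 s = 1 := by simp [echar]

theorem echar_zero_right (n : ℤ) : echar n 0 = 1 := by simp [echar]

theorem echar_mul (m n : ℤ) (s : ℝ) : echar m s * echar n s = echar (m + n) s := by
  simp only [echar, ← Complex.exp_add]; push_cast; ring_nf

theorem contDiff_echar (n : ℤ) : ContDiff ℝ (⊤ : ℕ∞) (echar n) := by
  unfold echar
  exact (contDiff_const.mul Complex.ofRealCLM.contDiff).cexp

theorem continuous_echar (n : ℤ) : Continuous (echar n) := (contDiff_echar n).continuous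

theorem hasDerivAt_echar (n : ℤ) (s : ℝ) :
    HasDerivAt (echar n) (2 * Real.pi * Complex.I * n * echar n s) s := by
  have := ((hasDerivAt_id s).ofReal_comp.const_mul (2 * Real.pi * Complex.I * n : ℂ)).cexp
  refine (this.congr_deriv ?_).congr_of_eventuallyEq (Filter.Eventually.of_forall fun x => ?_)
  · simp only [echar, id]; push_cast; ring
  · simp [echar]

/-- The `n`-th Fourier coefficient of `G` in its last (real) variable. -/
noncomputable def fcoef {V : Type} (n : ℤ) (G : V × ℝ → ℂ) (v : V) : ℂ :=
  ∫ s in (0 : ℝ)..1, echar (-n) s * G (v, s)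

section fcoef

variable {V : Type} [NormedAddCommGroup V] [NormedSpace ℝ V] {G : V × ℝ → ℂ}

theorem fcoef_contDiff [FiniteDimensional ℝ V] (n : ℤ) (hG : ContDiff ℝ (⊤ : ℕ∞) G) :
    ContDiff ℝ (⊤ : ℕ∞) (fcoef n G) :=
  contDiff_intervalIntegral_param (H := fun p => echar (-n) p.2 * G p)
    (((contDiff_echar _).comp contDiff_snd).mul hG)

theorem fcoef_fderiv [FiniteDimensional ℝ V] (n : ℤ) (hG : ContDiff ℝ (⊤ : ℕ∞) G) (v w : V) :
    fderiv ℝ (fcoef n G) v w = fcoef n (fun p => fderiv ℝ G p (w, 0)) v := by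
  have hH : ContDiff ℝ (⊤ : ℕ∞) (fun p : V × ℝ => echar (-n) p.2 * G p) :=
    ((contDiff_echar _).comp contDiff_snd).mul hG
  have h1 : ContDiff ℝ 1 (fun p : V × ℝ => echar (-n) p.2 * G p) := hH.of_le (by simp)
  have := (hasFDerivAt_intervalIntegral_param h1 v).fderiv
  unfold fcoef
  rw [this, ContinuousLinearMap.intervalIntegral_apply]
  · refine intervalIntegral.integral_congr fun s _ => ?_
    have hd : HasFDerivAt (fun p : V × ℝ => echar (-n) p.2)
        (((ContinuousLinearMap.toSpanSingleton ℝ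
          (2 * Real.pi * Complex.I * (-n : ℤ) * echar (-n) s))).comp
          (ContinuousLinearMap.snd ℝ V ℝ)) (v, s) :=
      HasFDerivAt.comp (g := echar (-n)) (f := Prod.snd) (v, s)
        (hasDerivAt_echar (-n) s).hasFDerivAt
        hasFDerivAt_snd
    have hg := (hG.differentiable (by simp) (v, s)).hasFDerivAt
    have hm : HasFDerivAt (fun p : V × ℝ => echar (-n) p.2 * G p) _ (v, s) := hd.mul hg
    simp [hm.fderiv]
  · have hc : Continuous fun p : V × ℝ =>
        (fderiv ℝ (fun p : V × ℝ => echar (-n) p.2 * G p) p).comp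
          (ContinuousLinearMap.inl ℝ V ℝ) :=
      (h1.continuous_fderiv one_ne_zero).clm_comp continuous_const
    exact (hc.comp (Continuous.prodMk_right v)).intervalIntegrable _ _

theorem fcoef_fderiv_last (n : ℤ) (hG : ContDiff ℝ (⊤ : ℕ∞) G) (v : V)
    (hper : G (v, 1) = G (v, 0)) :
    fcoef n (fun p => fderiv ℝ G p (0, 1)) v = 2 * Real.pi * Complex.I * n * fcoef n G v := by
  have hd : ∀ s, HasDerivAt (fun s => G (v, s)) (fderiv ℝ G (v, s) (0, 1)) s := fun s =>
    ((hG.differentiable (by simp) (v, s)).hasFDerivAt.comp_hasDerivAt s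
      ((hasDerivAt_const s v).prodMk (hasDerivAt_id s)))
  have hc : Continuous fun s => fderiv ℝ G (v, s) (0, 1) :=
    ((hG.continuous_fderiv (by simp)).comp (Continuous.prodMk_right v)).clm_apply continuous_const
  unfold fcoef
  rw [intervalIntegral.integral_mul_deriv_eq_deriv_mul (fun s _ => hasDerivAt_echar (-n) s)
    (fun s _ => hd s) ((continuous_const.mul (continuous_echar _)).intervalIntegrable _ _)
    (hc.intervalIntegrable _ _)]
  have h1 : echar (-n) 1 = 1 := by simpa using echar_int (-n) 1
  rw [h1, echar_zero_right, hper, ← intervalIntegral.integral_const_mul]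
  simp only [sub_self, zero_sub, ← intervalIntegral.integral_neg]
  refine intervalIntegral.integral_congr fun s _ => ?_
  push_cast
  ring

end fcoef

theorem fcoef_add {V : Type} [TopologicalSpace V] (n : ℤ) {G H : V × ℝ → ℂ} (hG : Continuous G)
    (hH : Continuous H) : fcoef n (fun p => G p + H p) = fun v => fcoef n G v + fcoef n H v := by
  funext v
  have h : ∀ {G : V × ℝ → ℂ}, Continuous G →
      IntervalIntegrable (fun s => echar (-n) s * G (v, s)) MeasureTheory.volume 0 1 := fun hG =>
    ((continuous_echar _).mul (hG.comp (Continuous.prodMk_right v))).intervalIntegrable _ _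
  unfold fcoef
  rw [← intervalIntegral.integral_add (h hG) (h hH)]
  simp only [mul_add]

theorem fcoef_smul {V : Type} (n : ℤ) (G : V × ℝ → ℂ) (c : V → ℂ) :
    fcoef n (fun p => c p.1 * G p) = fun v => c v * fcoef n G v := by
  funext v
  unfold fcoef
  rw [← intervalIntegral.integral_const_mul]
  refine intervalIntegral.integral_congr fun s _ => ?_
  simp only
  ring

theorem eq_zero_of_fourier_eq_zero {h : ℝ → ℂ} (hc : Continuous h) (hp : Function.Periodic h 1)
    (h0 : ∀ n : ℤ, ∫ s in (0 : ℝ)..1, echar (-n) s * h s = 0) : h = 0 := by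
  let g : C(AddCircle (1 : ℝ), ℂ) := ⟨hp.lift, continuous_coinduced_dom.2 hc⟩
  have hg : fourierCoeff g = 0 := by
    funext n
    rw [fourierCoeff_eq_intervalIntegral _ _ 0]
    simp only [zero_add, Pi.zero_apply, one_div, inv_one, one_smul]
    rw [← h0 n]
    refine intervalIntegral.integral_congr fun s _ => ?_
    simp only [fourier_coe_apply, echar, smul_eq_mul, g]
    simp
  funext x
  have := has_pointwise_sum_fourier_series_of_summable (f := g) (by rw [hg]; exact summable_zero) x
  rw [hg] at this
  simp only [Pi.zero_apply, zero_smul] at this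
  exact (this.unique hasSum_zero)

/-- Ladder argument: if `B` is the adjoint of `A` for a positive definite form and
`A B - B A = c > 0`, then the eigenvalues of `B A` are of the form `c N` with `N ∈ ℕ`. -/
theorem eigenvalue_of_ladder {E : Type*} [AddCommGroup E] [Module ℂ E] (q : E → E → ℂ)
    (hsmul : ∀ v (z : ℂ) w, q v (z • w) = z * q v w)
    (hpos : ∀ v, v ≠ 0 → ∃ r : ℝ, 0 < r ∧ q v v = r) (A B : Module.End ℂ E)
    (hadj : ∀ v w, q v (B w) = q (A v) w) {c : ℝ} (hc : 0 < c)
    (hcomm : ∀ v, A (B v) = B (A v) + (c : ℂ) • v) {μ : ℂ} {w : E} (hw : w ≠ 0)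
    (h : B (A w) = μ • w) : ∃ N : ℕ, μ = c * N := by
  obtain ⟨k, hk⟩ := exists_nat_gt (μ.re / c)
  rw [div_lt_iff₀ hc] at hk
  induction k generalizing μ w with
  | zero =>
    by_cases hAw : A w = 0
    · have : μ • w = 0 := by rw [← h, hAw, map_zero]
      exact ⟨0, by simpa using (smul_eq_zero.1 this).resolve_right hw⟩
    obtain ⟨r, hr, hr'⟩ := hpos w hw
    obtain ⟨s, hs, hs'⟩ := hpos (A w) hAw
    have h1 : μ * r = s := by rw [← hr', ← hs', ← hadj, h, hsmul]
    have h2 : μ.re * r = s := by simpa using congrArg Complex.re h1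
    simp only [Nat.cast_zero, zero_mul] at hk
    nlinarith
  | succ k ih =>
    by_cases hAw : A w = 0
    · have : μ • w = 0 := by rw [← h, hAw, map_zero]
      exact ⟨0, by simpa using (smul_eq_zero.1 this).resolve_right hw⟩
    have h3 : B (A (A w)) = (μ - c) • A w := by
      have := hcomm (A w)
      rw [h, map_smul] at this
      rw [sub_smul, this, add_sub_cancel_right]
    obtain ⟨N, hN⟩ := ih hAw h3 (by
      rw [Complex.sub_re, Complex.ofReal_re]
      push_cast at hk
      linarith)
    exact ⟨N + 1, by push_cast; linear_combination hN⟩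

theorem eq_zero_of_ladder_system {E : Type*} [AddCommGroup E] [Module ℂ E] (q : E → E → ℂ)
    (hsmul : ∀ v (z : ℂ) w, q v (z • w) = z * q v w)
    (hpos : ∀ v, v ≠ 0 → ∃ r : ℝ, 0 < r ∧ q v v = r) (A B : Module.End ℂ E)
    (hadj : ∀ v w, q v (B w) = q (A v) w) (hadj' : ∀ v w, q v (A w) = q (B v) w)
    {c : ℝ} (hc : c ≠ 0) (hcomm : ∀ v, A (B v) = B (A v) + (c : ℂ) • v) {P Q : ℂ}
    (hPQ : ∀ N : ℕ, P * Q ≠ -((|c| : ℝ) * N)) {u w : E} (hw : A w = Q • u)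
    (hu : B u = -(P • w)) : u = 0 ∧ w = 0 := by
  have hPQ0 : P * Q ≠ 0 := by simpa using hPQ 0
  have hP : P ≠ 0 := left_ne_zero_of_mul hPQ0
  have hQ : Q ≠ 0 := right_ne_zero_of_mul hPQ0
  rcases hc.lt_or_gt with hc | hc
  · have hu0 : u = 0 := by
      by_contra hne
      obtain ⟨N, hN⟩ := eigenvalue_of_ladder q hsmul hpos B A hadj' (neg_pos.2 hc)
        (fun v => by rw [hcomm]; push_cast; module) (μ := -(P * Q)) hne
        (by rw [hu, map_neg, map_smul, hw]; module)
      refine hPQ N ?_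
      rw [abs_of_neg hc]
      linear_combination -hN
    refine ⟨hu0, ?_⟩
    rw [hu0, map_zero, eq_comm, neg_eq_zero] at hu
    exact (smul_eq_zero.1 hu).resolve_left hP
  · have hw0 : w = 0 := by
      by_contra hne
      obtain ⟨N, hN⟩ := eigenvalue_of_ladder q hsmul hpos A B hadj hc hcomm (μ := -(P * Q)) hne
        (by rw [hw, map_smul, hu]; module)
      refine hPQ N ?_
      rw [abs_of_pos hc]
      linear_combination -hN
    refine ⟨?_, hw0⟩
    rw [hw0, map_zero, eq_comm] at hw
    exact (smul_eq_zero.1 hw).resolve_left hQ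

theorem ladder_ne_of_transcendental {b ρ : ℝ} (hb : b ≠ 0) (hρ : 0 < ρ)
    (htr : Transcendental ℚ (b ^ 2 * √ρ / (8 * Real.pi))) {k n : ℤ} (hn : n ≠ 0) (N : ℕ) :
    ((2 * Real.pi * k - Complex.I * b / 4 - Complex.I * (2 * Real.pi * n / (b * √ρ) : ℝ)) *
      (2 * Real.pi * k - Complex.I * b / 4 + Complex.I * (2 * Real.pi * n / (b * √ρ) : ℝ)) : ℂ)
      ≠ -((|2 * (2 * Real.pi * n / √ρ)| : ℝ) * N) := by
  intro h
  have hπ := Real.pi_pos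
  have hr : 0 < √ρ := Real.sqrt_pos.2 hρ
  generalize √ρ = r at h htr hr
  have habs : |2 * (2 * Real.pi * n / r)| = 4 * Real.pi * |(n : ℝ)| / r := by
    rw [abs_mul, abs_div, abs_mul, abs_mul, abs_of_pos hπ, abs_of_pos hr]
    simp; ring
  rw [habs] at h
  obtain ⟨e, he⟩ : ∃ e, e = 2 * Real.pi * n / (b * r) := ⟨_, rfl⟩
  rw [← he] at h
  obtain ⟨M, hM⟩ : ∃ M, M = 4 * Real.pi * |(n : ℝ)| / r * N := ⟨_, rfl⟩
  have h' : ((4 * Real.pi ^ 2 * k ^ 2 - b ^ 2 / 16 + e ^ 2 + M : ℝ) : ℂ)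
      + ((-(Real.pi * b * k) : ℝ) : ℂ) * Complex.I = 0 := by
    rw [hM]
    push_cast at h ⊢
    linear_combination h + ((e : ℂ) ^ 2 - b ^ 2 / 16) * Complex.I_sq
  have him := congrArg Complex.im h'
  have hre := congrArg Complex.re h'
  simp only [Complex.add_im, Complex.ofReal_im, Complex.im_ofReal_mul,
    Complex.I_im, Complex.zero_im, mul_one, zero_add] at him
  simp only [Complex.add_re, Complex.ofReal_re, Complex.re_ofReal_mul,
    Complex.I_re, Complex.zero_re, mul_zero, add_zero] at hre
  have hk : (k : ℝ) = 0 := by simpa [hπ.ne', hb] using him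
  rw [hk, hM] at hre
  have h1 : -b ^ 2 / 16 + e ^ 2 = -(4 * Real.pi * |(n : ℝ)| / r * N) := by
    linarith
  apply htr
  refine ⟨Polynomial.X ^ 2 - Polynomial.C (8 * (|n| : ℤ) * N : ℚ) * Polynomial.X
    - Polynomial.C ((n : ℚ) ^ 2), fun h0 => ?_, ?_⟩
  · have := congrArg (Polynomial.eval 0) h0
    simp [hn] at this
  · simp only [map_sub, map_mul, map_pow, Polynomial.aeval_X, Polynomial.aeval_C]
    simp only [he] at h1
    push_cast [eq_ratCast]
    field_simp at h1 ⊢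
    linarith

theorem contDiff_fderiv_apply {V E : Type*} [NormedAddCommGroup V] [NormedSpace ℝ V]
    [NormedAddCommGroup E] [NormedSpace ℝ E] {F : V → E} (hF : ContDiff ℝ (⊤ : ℕ∞) F) (w : V) :
    ContDiff ℝ (⊤ : ℕ∞) (fun p => fderiv ℝ F p w) :=
  (hF.fderiv_right (by simp)).clm_apply contDiff_const

theorem norm_echar (n : ℤ) (s : ℝ) : ‖echar n s‖ = 1 := by
  rw [echar, Complex.norm_exp]
  simp

/-- Smooth functions on `ℝ²` that are `1`-periodic in `y` and satisfy
`φ(x + 1, y) = exp (-2πi n y) φ(x, y)`. -/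
def quasiPeriodic (n : ℤ) : Submodule ℂ (ℝ × ℝ → ℂ) where
  carrier := {φ | ContDiff ℝ (⊤ : ℕ∞) φ ∧ (∀ x y, φ (x, y + 1) = φ (x, y)) ∧
    ∀ x y, φ (x + 1, y) = echar (-n) y * φ (x, y)}
  zero_mem' := ⟨contDiff_const, by simp, by simp⟩
  add_mem' := fun {φ ψ} hφ hψ => ⟨hφ.1.add hψ.1, fun x y => by simp [hφ.2.1, hψ.2.1],
    fun x y => by simp [hφ.2.2, hψ.2.2, mul_add]⟩
  smul_mem' := fun c φ hφ => ⟨contDiff_const.mul hφ.1, fun x y => by simp [hφ.2.1],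
    fun x y => by simp [hφ.2.2]; ring⟩

theorem fderiv_echar_snd_mul {φ : ℝ × ℝ → ℂ} (n : ℤ) (hφ : ContDiff ℝ (⊤ : ℕ∞) φ) (p w : ℝ × ℝ) :
    fderiv ℝ (fun p : ℝ × ℝ => echar n p.2 * φ p) p w =
      echar n p.2 * (fderiv ℝ φ p w + 2 * Real.pi * Complex.I * n * w.2 * φ p) := by
  have hd : HasFDerivAt (fun p : ℝ × ℝ => echar n p.2) _ p :=
    HasFDerivAt.comp (g := echar n) (f := Prod.snd) p (hasDerivAt_echar n p.2).hasFDerivAt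
      hasFDerivAt_snd
  have hm : HasFDerivAt (fun p : ℝ × ℝ => echar n p.2 * φ p) _ p :=
    hd.mul (hφ.differentiable (by simp) p).hasFDerivAt
  rw [hm.fderiv]
  simp
  ring

theorem fderiv_quasiPeriodic {n : ℤ} {φ : ℝ × ℝ → ℂ} (hφ : φ ∈ quasiPeriodic n) (x y : ℝ)
    (w : ℝ × ℝ) : fderiv ℝ φ (x, y + 1) w = fderiv ℝ φ (x, y) w ∧
      fderiv ℝ φ (x + 1, y) w =
        echar (-n) y * (fderiv ℝ φ (x, y) w - 2 * Real.pi * Complex.I * n * w.2 * φ (x, y)) := by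
  constructor
  · have h : (fun p => φ (p + ((0, 1) : ℝ × ℝ))) = φ := by
      funext ⟨x, y⟩
      simpa using hφ.2.1 x y
    have := fderiv_comp_add_right (𝕜 := ℝ) (f := φ) (x := (x, y)) ((0, 1) : ℝ × ℝ)
    rw [h] at this
    simp [this]
  · have h : (fun p => φ (p + ((1, 0) : ℝ × ℝ))) = fun p => echar (-n) p.2 * φ p := by
      funext ⟨x, y⟩
      simpa using hφ.2.2 x y
    have := fderiv_comp_add_right (𝕜 := ℝ) (f := φ) (x := (x, y)) ((1, 0) : ℝ × ℝ)
    rw [h] at this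
    have h2 := fderiv_echar_snd_mul (-n) hφ.1 (x, y) w
    rw [this] at h2
    simp at h2
    rw [h2]
    ring

/-- The operator `∂_x` on quasi-periodic functions. -/
noncomputable def quasiX (n : ℤ) : Module.End ℂ (quasiPeriodic n) where
  toFun φ := ⟨fun p => fderiv ℝ φ.1 p (1, 0), contDiff_fderiv_apply φ.2.1 _,
    fun x y => (fderiv_quasiPeriodic φ.2 x y _).1,
    fun x y => by simp [(fderiv_quasiPeriodic φ.2 x y _).2]⟩
  map_add' φ ψ := by
    ext p
    simp [fderiv_add (φ.2.1.differentiable (by simp) p) (ψ.2.1.differentiable (by simp) p)]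
  map_smul' c φ := by
    ext p
    simp [fderiv_const_smul (φ.2.1.differentiable (by simp) p)]

/-- The operator `∂_y + 2πi n x` on quasi-periodic functions. -/
noncomputable def quasiD (n : ℤ) : Module.End ℂ (quasiPeriodic n) where
  toFun φ := ⟨fun p => fderiv ℝ φ.1 p (0, 1) + 2 * Real.pi * Complex.I * n * p.1 * φ.1 p,
    (contDiff_fderiv_apply φ.2.1 _).add
      ((contDiff_const.mul (Complex.ofRealCLM.contDiff.comp contDiff_fst)).mul φ.2.1),
    fun x y => by simp [(fderiv_quasiPeriodic φ.2 x y _).1, φ.2.2.1],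
    fun x y => by simp [(fderiv_quasiPeriodic φ.2 x y _).2, φ.2.2.2]; ring⟩
  map_add' φ ψ := by
    ext p
    simp [fderiv_add (φ.2.1.differentiable (by simp) p) (ψ.2.1.differentiable (by simp) p)]
    ring
  map_smul' c φ := by
    ext p
    simp [fderiv_const_smul (φ.2.1.differentiable (by simp) p)]
    ring

theorem quasiX_quasiD (n : ℤ) (φ : quasiPeriodic n) :
    quasiX n (quasiD n φ) = quasiD n (quasiX n φ) + (2 * Real.pi * Complex.I * n) • φ := by
  ext p
  have hφ := φ.2.1
  have hsymm : IsSymmSndFDerivAt ℝ φ.1 p :=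
    hφ.contDiffAt.isSymmSndFDerivAt (by
      simp [minSmoothness_of_isRCLikeNormedField]; exact WithTop.coe_le_coe.2 le_top)
  have hd2 : DifferentiableAt ℝ (fderiv ℝ φ.1) p :=
    (hφ.fderiv_right (m := (⊤ : ℕ∞)) (by simp)).differentiable (by simp) p
  have h1 : ∀ v w : ℝ × ℝ, fderiv ℝ (fun p => fderiv ℝ φ.1 p v) p w
      = fderiv ℝ (fderiv ℝ φ.1) p w v := fun v w => by
    rw [fderiv_clm_apply hd2 (differentiableAt_const v)]
    simp
  have hx : HasFDerivAt (fun p : ℝ × ℝ => (p.1 : ℂ))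
      (Complex.ofRealCLM.comp (ContinuousLinearMap.fst ℝ ℝ ℝ)) p :=
    (Complex.ofRealCLM.comp (ContinuousLinearMap.fst ℝ ℝ ℝ)).hasFDerivAt
  have h2 : HasFDerivAt (fun p : ℝ × ℝ => 2 * Real.pi * Complex.I * n * p.1 * φ.1 p) _ p :=
    (hx.const_mul (2 * Real.pi * Complex.I * n : ℂ)).mul
      (hφ.differentiable (by simp) p).hasFDerivAt
  have h3 : HasFDerivAt (fun p => fderiv ℝ φ.1 p (0, 1)
      + 2 * Real.pi * Complex.I * n * p.1 * φ.1 p) _ p :=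
    ((contDiff_fderiv_apply hφ (0, 1)).differentiable (by simp) p).hasFDerivAt.add h2
  simp only [quasiX, quasiD, LinearMap.coe_mk, AddHom.coe_mk, Submodule.coe_add,
    Submodule.coe_smul, Pi.add_apply, Pi.smul_apply]
  rw [h3.fderiv]
  simp [h1, hsymm.eq (1, 0) (0, 1)]
  ring

theorem integral_integral_fderiv_fst {H : ℝ × ℝ → ℂ} (hH : ContDiff ℝ (⊤ : ℕ∞) H)
    (hper : ∀ y, H (1, y) = H (0, y)) :
    ∫ x in (0 : ℝ)..1, ∫ y in (0 : ℝ)..1, fderiv ℝ H (x, y) (1, 0) = 0 := by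
  have h0 : ∀ (G : ℝ × ℝ → ℂ) (x : ℝ), fcoef 0 G x = ∫ y in (0 : ℝ)..1, G (x, y) := by
    simp [fcoef, echar_zero_left]
  have hc := fcoef_contDiff 0 hH
  have hd : ∀ x, HasDerivAt (fcoef 0 H) (fcoef 0 (fun p => fderiv ℝ H p (1, 0)) x) x := fun x => by
    rw [← fcoef_fderiv 0 hH x 1]
    exact (hc.differentiable (by simp) x).hasFDerivAt.hasDerivAt
  simp only [← h0 (fun p => fderiv ℝ H p (1, 0))]
  rw [intervalIntegral.integral_eq_sub_of_hasDerivAt (fun x _ => hd x)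
    ((fcoef_contDiff 0 (contDiff_fderiv_apply hH _)).continuous.intervalIntegrable _ _)]
  simp [h0, hper]

theorem integral_integral_fderiv_snd {H : ℝ × ℝ → ℂ} (hH : ContDiff ℝ (⊤ : ℕ∞) H)
    (hper : ∀ x, H (x, 1) = H (x, 0)) :
    ∫ x in (0 : ℝ)..1, ∫ y in (0 : ℝ)..1, fderiv ℝ H (x, y) (0, 1) = 0 := by
  have h : ∀ x, ∫ y in (0 : ℝ)..1, fderiv ℝ H (x, y) (0, 1) = 0 := fun x => by
    simpa [fcoef, echar_zero_left] using fcoef_fderiv_last 0 hH x (hper x)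
  simp [h]

theorem integral_integral_add {F G : ℝ × ℝ → ℂ} (hF : Continuous F) (hG : Continuous G) :
    ∫ x in (0 : ℝ)..1, ∫ y in (0 : ℝ)..1, (F (x, y) + G (x, y)) =
      (∫ x in (0 : ℝ)..1, ∫ y in (0 : ℝ)..1, F (x, y)) +
        ∫ x in (0 : ℝ)..1, ∫ y in (0 : ℝ)..1, G (x, y) := by
  have hi : ∀ {F : ℝ × ℝ → ℂ}, Continuous F → ∀ x,
      IntervalIntegrable (fun y => F (x, y)) MeasureTheory.volume 0 1 := fun hF x =>
    (hF.comp (Continuous.prodMk_right x)).intervalIntegrable _ _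
  have ho : ∀ {F : ℝ × ℝ → ℂ}, Continuous F →
      IntervalIntegrable (fun x => ∫ y in (0 : ℝ)..1, F (x, y)) MeasureTheory.volume 0 1 :=
    fun {F} hF => (intervalIntegral.continuous_parametric_intervalIntegral_of_continuous'
      (f := fun x y => F (x, y)) (by simpa [Function.uncurry_def] using hF) 0 1
      ).intervalIntegrable _ _
  rw [← intervalIntegral.integral_add (ho hF) (ho hG)]
  refine intervalIntegral.integral_congr fun x _ => ?_
  exact intervalIntegral.integral_add (hi hF x) (hi hG x)

/-- The `L²` form on quasi-periodic functions. -/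
noncomputable def quasiForm {n : ℤ} (φ ψ : quasiPeriodic n) : ℂ :=
  ∫ x in (0 : ℝ)..1, ∫ y in (0 : ℝ)..1, star (φ.1 (x, y)) * ψ.1 (x, y)

section quasiForm

variable {n : ℤ} (φ ψ χ : quasiPeriodic n)

theorem continuous_star_mul : Continuous fun p => star (φ.1 p) * ψ.1 p :=
  φ.2.1.continuous.star.mul ψ.2.1.continuous

theorem quasiForm_smul_right (z : ℂ) : quasiForm φ (z • ψ) = z * quasiForm φ ψ := by
  unfold quasiForm
  simp only [← intervalIntegral.integral_const_mul]
  simp [mul_left_comm]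

theorem quasiForm_smul_left (z : ℂ) : quasiForm (z • φ) ψ = star z * quasiForm φ ψ := by
  unfold quasiForm
  simp only [← intervalIntegral.integral_const_mul]
  simp [mul_assoc]

theorem quasiForm_add_right : quasiForm φ (ψ + χ) = quasiForm φ ψ + quasiForm φ χ := by
  unfold quasiForm
  rw [← integral_integral_add (continuous_star_mul φ ψ) (continuous_star_mul φ χ)]
  simp [mul_add]

theorem quasiForm_add_left : quasiForm (φ + ψ) χ = quasiForm φ χ + quasiForm ψ χ := by
  unfold quasiForm
  rw [← integral_integral_add (continuous_star_mul φ χ) (continuous_star_mul ψ χ)]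
  simp [add_mul]

theorem fderiv_star_mul (p w : ℝ × ℝ) : fderiv ℝ (fun p => star (φ.1 p) * ψ.1 p) p w =
    star (φ.1 p) * fderiv ℝ ψ.1 p w + star (fderiv ℝ φ.1 p w) * ψ.1 p := by
  have h : HasFDerivAt (fun p => star (φ.1 p) * ψ.1 p) _ p :=
    (φ.2.1.differentiable (by simp) p).hasFDerivAt.star.mul
      (ψ.2.1.differentiable (by simp) p).hasFDerivAt
  rw [h.fderiv]
  simp
  ring

theorem contDiff_star_mul : ContDiff ℝ (⊤ : ℕ∞) fun p => star (φ.1 p) * ψ.1 p :=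
  ((starL' ℝ (A := ℂ)).contDiff.comp φ.2.1).mul ψ.2.1

theorem star_mul_echar (m : ℤ) (s : ℝ) : star (echar m s) * echar m s = 1 := by
  have := Complex.normSq_eq_conj_mul_self (z := echar m s)
  rw [Complex.normSq_eq_norm_sq, norm_echar] at this
  simpa using this.symm

theorem quasiForm_quasiX : quasiForm φ (quasiX n ψ) = -quasiForm (quasiX n φ) ψ := by
  rw [← add_eq_zero_iff_eq_neg]
  unfold quasiForm
  rw [← integral_integral_add (continuous_star_mul φ _) (continuous_star_mul _ ψ)]
  have h := integral_integral_fderiv_fst (contDiff_star_mul φ ψ) fun y => by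
    have h1 := φ.2.2.2 0 y
    have h2 := ψ.2.2.2 0 y
    rw [zero_add] at h1 h2
    rw [h1, h2, star_mul']
    linear_combination star (φ.1 (0, y)) * ψ.1 (0, y) * star_mul_echar (-n) y
  rw [← h]
  congr! 5 with x
  rw [fderiv_star_mul]
  rfl

theorem quasiForm_quasiD : quasiForm φ (quasiD n ψ) = -quasiForm (quasiD n φ) ψ := by
  rw [← add_eq_zero_iff_eq_neg]
  unfold quasiForm
  rw [← integral_integral_add (continuous_star_mul φ _) (continuous_star_mul _ ψ)]
  have h := integral_integral_fderiv_snd (contDiff_star_mul φ ψ) fun x => by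
    have h1 := φ.2.2.1 x 0
    have h2 := ψ.2.2.1 x 0
    rw [zero_add] at h1 h2
    rw [h1, h2]
  rw [← h]
  congr! 5 with x y
  rw [fderiv_star_mul]
  simp [quasiD]
  ring

theorem quasiForm_self_pos (hφ : φ ≠ 0) : ∃ r : ℝ, 0 < r ∧ quasiForm φ φ = r := by
  have hn : Continuous fun p => ‖φ.1 p‖ ^ 2 := φ.2.1.continuous.norm.pow 2
  refine ⟨∫ x in (0 : ℝ)..1, ∫ y in (0 : ℝ)..1, ‖φ.1 (x, y)‖ ^ 2, ?_, ?_⟩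
  · obtain ⟨⟨x, y⟩, hxy⟩ : ∃ p, φ.1 p ≠ 0 := by
      by_contra! h
      exact hφ (Subtype.ext (funext h))
    have hpx : ∀ y, Function.Periodic (fun x => ‖φ.1 (x, y)‖) 1 := fun y x => by
      simp [φ.2.2.2, norm_echar]
    have hpy : ∀ x, Function.Periodic (fun y => ‖φ.1 (x, y)‖) 1 := fun x y => by
      simp [φ.2.2.1]
    obtain ⟨x', hx', hxx⟩ := (hpx y).exists_mem_Ico₀ one_pos x
    obtain ⟨y', hy', hyy⟩ := (hpy x').exists_mem_Ico₀ one_pos y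
    have hpos : 0 < ‖φ.1 (x', y')‖ ^ 2 := by
      rw [← hyy, ← hxx]
      positivity
    refine intervalIntegral.integral_pos one_pos
      (intervalIntegral.continuous_parametric_intervalIntegral_of_continuous'
        (f := fun x y => ‖φ.1 (x, y)‖ ^ 2) (by simpa [Function.uncurry_def] using hn) 0 1
        ).continuousOn
      (fun x _ => intervalIntegral.integral_nonneg zero_le_one fun y _ => by positivity)
      ⟨x', Set.Ico_subset_Icc_self hx', ?_⟩
    exact intervalIntegral.integral_pos one_pos
      (hn.comp (Continuous.prodMk_right x')).continuousOn (fun y _ => by positivity)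
      ⟨y', Set.Ico_subset_Icc_self hy', hpos⟩
  · unfold quasiForm
    simp only [← intervalIntegral.integral_ofReal]
    congr! 5 with x y
    simpa using Complex.conj_mul' (φ.1 (x, y))

end quasiForm

/-- The operator `ε (∂_x - i b / 4) + (√ρ)⁻¹ (-i D - 2πna/b)` on quasi-periodic functions. For
`ε = ±1` these operators are adjoint to each other. -/
noncomputable def quasiLadder (a b r : ℝ) (n : ℤ) (ε : ℝ) : Module.End ℂ (quasiPeriodic n) :=
  (ε : ℂ) • quasiX n + (-(ε * Complex.I * b / 4)) • 1 + (-(Complex.I / r)) • quasiD n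
    + (-(2 * Real.pi * n * a / (b * r)) : ℂ) • 1

theorem quasiForm_quasiLadder (a b r : ℝ) {n : ℤ} (ε : ℝ) (φ ψ : quasiPeriodic n) :
    quasiForm φ (quasiLadder a b r n (-ε) ψ) = quasiForm (quasiLadder a b r n ε φ) ψ := by
  simp only [quasiLadder, LinearMap.add_apply, LinearMap.smul_apply,
    quasiForm_add_left, quasiForm_add_right, quasiForm_smul_left, quasiForm_smul_right,
    quasiForm_quasiX, quasiForm_quasiD, Module.End.one_apply]
  simp
  ring

theorem quasiLadder_comm (a b r : ℝ) (n : ℤ) (v : quasiPeriodic n) :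
    quasiLadder a b r n 1 (quasiLadder a b r n (-1) v) =
      quasiLadder a b r n (-1) (quasiLadder a b r n 1 v) +
        ((2 * (2 * Real.pi * n / r) : ℝ) : ℂ) • v := by
  ext p
  simp only [quasiLadder, LinearMap.add_apply, LinearMap.smul_apply, map_add, map_smul,
    quasiX_quasiD, Module.End.one_apply, Submodule.coe_add, Submodule.coe_smul,
    Pi.add_apply, Pi.smul_apply, smul_eq_mul]
  push_cast
  linear_combination (-4 * Real.pi * n / r * v.1 p : ℂ) * Complex.I_sq

theorem ladder_system_algebra {a b r k n p x1 x2 d1 d2 f g : ℂ} (hr : r ≠ 0)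
    (h1 : -(d1 - ((a + Complex.I) / b) * (2 * p * Complex.I * n * f))
      + (2 * p * Complex.I * k * g + Complex.I * x2) + b / 2 * g = 0)
    (h2 : r ^ 2 * (2 * p * Complex.I * k * f - Complex.I * x1)
      + (d2 - ((a - Complex.I) / b) * (2 * p * Complex.I * n * g)) = 0) :
    (1 * (r * x1 - x2) + -(1 * Complex.I * b / 4) * (r * f - g) +
      -(Complex.I / r) * (r * d1 - d2) + -(2 * p * n * a / (b * r)) * (r * f - g) =
      (2 * p * k - Complex.I * b / 4 + Complex.I * (2 * p * n / (b * r))) * (r * f + g)) ∧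
    (-1 * (r * x1 + x2) + -(-1 * Complex.I * b / 4) * (r * f + g) +
      -(Complex.I / r) * (r * d1 + d2) + -(2 * p * n * a / (b * r)) * (r * f + g) =
      -((2 * p * k - Complex.I * b / 4 - Complex.I * (2 * p * n / (b * r))) * (r * f - g))) := by
  have hinv : r * r⁻¹ = 1 := mul_inv_cancel₀ hr
  constructor
  · linear_combination Complex.I * h1 + Complex.I / r * h2
      - (((a + Complex.I) / b) * (2 * p * n * f) + 2 * p * k * g
      + x2 + r * (2 * p * k * f - x1) - ((a - Complex.I) / b) * (2 * p * n * g) / r) * Complex.I_sq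
      + (-(2 * Complex.I * f * p * n * b⁻¹) - Complex.I * d1 - 2 * f * p * n * a * b⁻¹
        + r * Complex.I ^ 2 * (x1 - 2 * f * p * k)) * hinv
  · linear_combination Complex.I * h1 - Complex.I / r * h2
      - (((a + Complex.I) / b) * (2 * p * n * f) + 2 * p * k * g
      + x2 - r * (2 * p * k * f - x1) + ((a - Complex.I) / b) * (2 * p * n * g) / r) * Complex.I_sq
      + (-(2 * Complex.I * f * p * n * b⁻¹) - Complex.I * d1 - 2 * f * p * n * a * b⁻¹
        - r * Complex.I ^ 2 * (x1 - 2 * f * p * k)) * hinv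

theorem quasiPeriodic_system_eq_zero {a b ρ : ℝ} (hb : b ≠ 0) (hρ : 0 < ρ)
    (htr : Transcendental ℚ (b ^ 2 * √ρ / (8 * Real.pi))) {k n : ℤ} (hn : n ≠ 0)
    {φ ψ : quasiPeriodic n}
    (h1 : ∀ p, -((quasiD n φ).1 p - ((a + Complex.I) / b) * (2 * Real.pi * Complex.I * n * φ.1 p))
      + (2 * Real.pi * Complex.I * k * ψ.1 p + Complex.I * (quasiX n ψ).1 p)
      + b / 2 * ψ.1 p = 0)
    (h2 : ∀ p, ρ * (2 * Real.pi * Complex.I * k * φ.1 p - Complex.I * (quasiX n φ).1 p)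
      + ((quasiD n ψ).1 p - ((a - Complex.I) / b) * (2 * Real.pi * Complex.I * n * ψ.1 p)) = 0) :
    φ = 0 ∧ ψ = 0 := by
  have hr : 0 < √ρ := Real.sqrt_pos.2 hρ
  have hsq : (√ρ : ℂ) ^ 2 = ρ := by exact_mod_cast Real.sq_sqrt hρ.le
  have hladder := fun N => ladder_ne_of_transcendental hb hρ htr (k := k) hn N
  simp only [← hsq] at h2
  generalize √ρ = r at hr h2 hladder
  have hr' : (r : ℂ) ≠ 0 := by exact_mod_cast hr.ne'
  have hc : 2 * (2 * Real.pi * n / r) ≠ 0 := by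
    have := Real.pi_pos.ne'
    have : (n : ℝ) ≠ 0 := by exact_mod_cast hn
    positivity
  obtain ⟨hu, hw⟩ : (r : ℂ) • φ + ψ = 0 ∧ (r : ℂ) • φ - ψ = 0 := by
    refine eq_zero_of_ladder_system (E := quasiPeriodic n) quasiForm
      (by intro v z w; exact quasiForm_smul_right v w z)
      (by intro v hv; exact quasiForm_self_pos v hv)
      (quasiLadder a b r n 1) (quasiLadder a b r n (-1))
      (quasiForm_quasiLadder a b r 1) (fun v w => ?_) hc
      (quasiLadder_comm a b r n) hladder ?_ ?_
    · simpa only [neg_neg] using quasiForm_quasiLadder a b r (-1) v w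
    · ext p
      simp only [quasiLadder, LinearMap.add_apply, LinearMap.smul_apply, map_sub,
        map_smul, Module.End.one_apply, Submodule.coe_add, Submodule.coe_sub, Submodule.coe_smul,
        Pi.add_apply, Pi.sub_apply, Pi.smul_apply, smul_eq_mul]
      push_cast
      linear_combination (ladder_system_algebra hr' (h1 p) (h2 p)).1
    · ext p
      simp only [quasiLadder, LinearMap.add_apply, LinearMap.smul_apply, map_add,
        map_smul, Module.End.one_apply, Submodule.coe_add, Submodule.coe_sub, Submodule.coe_smul,
        Submodule.coe_neg, Pi.add_apply, Pi.sub_apply, Pi.neg_apply, Pi.smul_apply, smul_eq_mul]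
      push_cast
      linear_combination (ladder_system_algebra hr' (h1 p) (h2 p)).2
  have hφ : φ = 0 := by
    have : ((2 : ℂ) * r) • φ = 0 := by
      have h := congrArg₂ (· + ·) hu hw
      simp only [add_zero] at h
      rw [← h]
      module
    exact (smul_eq_zero.1 this).resolve_left (by simp [hr'])
  exact ⟨hφ, by simpa [hφ] using hu⟩

/-- The permutation `(((x, y), t), z) ↦ (t, x, y, z)` of the coordinates. -/
def ktPerm : ((ℝ × ℝ) × ℝ) × ℝ →L[ℝ] ℝ × ℝ × ℝ × ℝ :=
  ((ContinuousLinearMap.snd ℝ (ℝ × ℝ) ℝ).comp (ContinuousLinearMap.fst ℝ _ ℝ)).prod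
    ((((ContinuousLinearMap.fst ℝ ℝ ℝ).comp (ContinuousLinearMap.fst ℝ (ℝ × ℝ) ℝ)).comp
      (ContinuousLinearMap.fst ℝ _ ℝ)).prod
    ((((ContinuousLinearMap.snd ℝ ℝ ℝ).comp (ContinuousLinearMap.fst ℝ (ℝ × ℝ) ℝ)).comp
      (ContinuousLinearMap.fst ℝ _ ℝ)).prod (ContinuousLinearMap.snd ℝ _ ℝ)))

theorem fderiv_comp_ktPerm {F : ℝ × ℝ × ℝ × ℝ → ℂ} (hF : ContDiff ℝ (⊤ : ℕ∞) F)
    (q w : ((ℝ × ℝ) × ℝ) × ℝ) :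
    fderiv ℝ (F ∘ ktPerm) q w = fderiv ℝ F (ktPerm q) (ktPerm w) := by
  rw [fderiv_comp q (hF.differentiable (by simp) _) ktPerm.differentiableAt,
    ContinuousLinearMap.fderiv]
  rfl

/-- The Fourier coefficient of index `k` in `t` and `n` in `z`, as a function of `(x, y)`. -/
noncomputable def ktCoef (k n : ℤ) (F : ℝ × ℝ × ℝ × ℝ → ℂ) : ℝ × ℝ → ℂ :=
  fcoef k (fcoef n (F ∘ ktPerm))

section ktCoef

variable {F G : ℝ × ℝ × ℝ × ℝ → ℂ}

theorem fcoef_continuous {V : Type} [TopologicalSpace V] [FirstCountableTopology V] (n : ℤ)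
    {G : V × ℝ → ℂ} (hG : Continuous G) : Continuous (fcoef n G) := by
  unfold fcoef
  exact intervalIntegral.continuous_parametric_intervalIntegral_of_continuous'
    (f := fun v s => echar (-n) s * G (v, s))
    (((continuous_echar _).comp continuous_snd).mul hG) 0 1

theorem ktCoef_add (k n : ℤ) (hF : Continuous F) (hG : Continuous G) :
    ktCoef k n (fun p => F p + G p) = fun v => ktCoef k n F v + ktCoef k n G v := by
  unfold ktCoef
  have := fcoef_add n (hF.comp ktPerm.continuous) (hG.comp ktPerm.continuous)
  rw [← fcoef_add k (fcoef_continuous n (hF.comp ktPerm.continuous))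
    (fcoef_continuous n (hG.comp ktPerm.continuous)), ← this]
  rfl

theorem ktCoef_mul (k n : ℤ) (c : ℝ × ℝ → ℂ) (F : ℝ × ℝ × ℝ × ℝ → ℂ) :
    ktCoef k n (fun p => c (p.2.1, p.2.2.1) * F p) = fun v => c v * ktCoef k n F v := by
  unfold ktCoef
  rw [← fcoef_smul k, ← fcoef_smul n _ (fun p : (ℝ × ℝ) × ℝ => c p.1)]
  rfl

theorem ktCoef_contDiff (k n : ℤ) (hF : ContDiff ℝ (⊤ : ℕ∞) F) :
    ContDiff ℝ (⊤ : ℕ∞) (ktCoef k n F) :=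
  fcoef_contDiff k (fcoef_contDiff n (hF.comp ktPerm.contDiff))

theorem ktCoef_fderiv (k n : ℤ) (hF : ContDiff ℝ (⊤ : ℕ∞) F) (v w : ℝ × ℝ) :
    fderiv ℝ (ktCoef k n F) v w = ktCoef k n (fun p => fderiv ℝ F p (0, w.1, w.2, 0)) v := by
  have h := hF.comp ktPerm.contDiff
  unfold ktCoef
  rw [fcoef_fderiv k (fcoef_contDiff n h)]
  simp only [fcoef_fderiv n h, fderiv_comp_ktPerm hF]
  rfl

theorem ktCoef_dT (k n : ℤ) (hF : ContDiff ℝ (⊤ : ℕ∞) F) (hG : GammaInvariant F) (v : ℝ × ℝ) :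
    ktCoef k n (dT F) v = 2 * Real.pi * Complex.I * k * ktCoef k n F v := by
  have h := hF.comp ktPerm.contDiff
  unfold ktCoef
  rw [← fcoef_fderiv_last k (fcoef_contDiff n h)]
  · simp only [fcoef_fderiv n h, fderiv_comp_ktPerm hF]
    rfl
  · unfold fcoef
    refine intervalIntegral.integral_congr fun s _ => ?_
    have := hG 0 v.1 v.2 s 1 0 0 0
    simp at this
    simp [ktPerm, this]

theorem ktCoef_dZ (k n : ℤ) (hF : ContDiff ℝ (⊤ : ℕ∞) F) (hG : GammaInvariant F) (v : ℝ × ℝ) :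
    ktCoef k n (dZ F) v = 2 * Real.pi * Complex.I * n * ktCoef k n F v := by
  have h := hF.comp ktPerm.contDiff
  have h1 : fcoef n (dZ F ∘ ktPerm) =
      fun p => 2 * Real.pi * Complex.I * n * fcoef n (F ∘ ktPerm) p := by
    funext p
    rw [← fcoef_fderiv_last n h]
    · simp only [fderiv_comp_ktPerm hF]
      rfl
    · have := hG p.2 p.1.1 p.1.2 0 0 0 0 1
      simp at this
      simp [ktPerm, this]
  unfold ktCoef
  rw [h1, fcoef_smul k _ (fun _ => 2 * Real.pi * Complex.I * n)]

theorem ktCoef_mem_quasiPeriodic (k n : ℤ) (hF : ContDiff ℝ (⊤ : ℕ∞) F) (hG : GammaInvariant F) :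
    ktCoef k n F ∈ quasiPeriodic n := by
  refine ⟨ktCoef_contDiff k n hF, fun x y => ?_, fun x y => ?_⟩
  · unfold ktCoef fcoef
    refine intervalIntegral.integral_congr fun t _ => ?_
    congr 1
    refine intervalIntegral.integral_congr fun z _ => ?_
    have := hG t x y z 0 0 1 0
    simp at this
    simp [ktPerm, this]
  · have h1 : ∀ t, fcoef n (F ∘ ktPerm) ((x + 1, y), t) =
        echar (-n) y * fcoef n (F ∘ ktPerm) ((x, y), t) := by
      intro t
      unfold fcoef
      rw [← intervalIntegral.integral_const_mul]
      have h2 : Function.Periodic (fun z => echar (-n) z * F (t, x + 1, y, z)) 1 := by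
        intro z
        have := hG t (x + 1) y z 0 0 0 1
        simp at this
        have h3 := echar_int (-n) 1
        simp at h3
        simp [this, echar_add, h3]
      have h4 := h2.intervalIntegral_add_eq y 0
      have h5 := intervalIntegral.integral_comp_add_right (a := 0) (b := 1)
        (fun z => echar (-n) z * F (t, x + 1, y, z)) y
      rw [zero_add] at h4 h5
      rw [add_comm 1 y] at h5
      calc _ = _ := h4.symm
        _ = _ := h5.symm
        _ = _ := ?_
      refine intervalIntegral.integral_congr fun z _ => ?_
      have := hG t x y z 0 1 0 0
      simp at this
      simp [this, echar_add, ktPerm]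
      ring
    unfold ktCoef
    generalize fcoef n (F ∘ ktPerm) = A at h1
    unfold fcoef
    rw [← intervalIntegral.integral_const_mul]
    refine intervalIntegral.integral_congr fun t _ => ?_
    simp only [h1]
    ring

end ktCoef

theorem continuous_fderiv_apply {F : ℝ × ℝ × ℝ × ℝ → ℂ} (hF : ContDiff ℝ (⊤ : ℕ∞) F)
    (w : ℝ × ℝ × ℝ × ℝ) : Continuous (fun p => fderiv ℝ F p w) :=
  (contDiff_fderiv_apply hF w).continuous

theorem ktCoef_relation (k n : ℤ) {c₁ c₂ c₃ c₄ c₅ : ℝ × ℝ → ℂ} {A B C D E : ℝ × ℝ × ℝ × ℝ → ℂ}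
    (hc₁ : Continuous c₁) (hc₂ : Continuous c₂) (hc₃ : Continuous c₃) (hc₄ : Continuous c₄)
    (hc₅ : Continuous c₅) (hA : Continuous A) (hB : Continuous B) (hC : Continuous C)
    (hD : Continuous D) (hE : Continuous E)
    (h : ∀ p, c₁ (p.2.1, p.2.2.1) * A p + (c₂ (p.2.1, p.2.2.1) * B p + (c₃ (p.2.1, p.2.2.1) * C p +
      (c₄ (p.2.1, p.2.2.1) * D p + c₅ (p.2.1, p.2.2.1) * E p))) = 0) (v : ℝ × ℝ) :
    c₁ v * ktCoef k n A v + (c₂ v * ktCoef k n B v + (c₃ v * ktCoef k n C v +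
      (c₄ v * ktCoef k n D v + c₅ v * ktCoef k n E v))) = 0 := by
  have hm : ∀ {c : ℝ × ℝ → ℂ} {F : ℝ × ℝ × ℝ × ℝ → ℂ}, Continuous c → Continuous F →
      Continuous fun p => c (p.2.1, p.2.2.1) * F p := fun hc hF =>
    (hc.comp (by fun_prop : Continuous fun p : ℝ × ℝ × ℝ × ℝ => (p.2.1, p.2.2.1))).mul hF
  have key := congrFun (congrArg (ktCoef k n) (funext h)) v
  have h0 : ktCoef k n (fun _ => 0) v = 0 := by simp [ktCoef, fcoef]
  have h₅ := hm hc₅ hE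
  have h₄ := (hm hc₄ hD).fun_add h₅
  have h₃ := (hm hc₃ hC).fun_add h₄
  have h₂ := (hm hc₂ hB).fun_add h₃
  rw [h0, ktCoef_add k n (hm hc₁ hA) h₂, ktCoef_add k n (hm hc₂ hB) h₃,
    ktCoef_add k n (hm hc₃ hC) h₄, ktCoef_add k n (hm hc₄ hD) h₅] at key
  simpa only [ktCoef_mul] using key

theorem ktCoef_dX (k n : ℤ) {F : ℝ × ℝ × ℝ × ℝ → ℂ} (hF : ContDiff ℝ (⊤ : ℕ∞) F) (v : ℝ × ℝ) :
    ktCoef k n (dX F) v = fderiv ℝ (ktCoef k n F) v (1, 0) :=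
  (ktCoef_fderiv k n hF v (1, 0)).symm

theorem ktCoef_dY (k n : ℤ) {F : ℝ × ℝ × ℝ × ℝ → ℂ} (hF : ContDiff ℝ (⊤ : ℕ∞) F) (v : ℝ × ℝ) :
    ktCoef k n (dY F) v = fderiv ℝ (ktCoef k n F) v (0, 1) :=
  (ktCoef_fderiv k n hF v (0, 1)).symm

theorem ktCoef_solution {a b ρ : ℝ} {f g : ℝ × ℝ × ℝ × ℝ → ℂ} (h : (f, g) ∈ solutionSet a b ρ)
    (k n : ℤ) (p : ℝ × ℝ) :
    -((fderiv ℝ (ktCoef k n f) p (0, 1) + 2 * Real.pi * Complex.I * n * p.1 * ktCoef k n f p)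
        - ((a + Complex.I) / b) * (2 * Real.pi * Complex.I * n * ktCoef k n f p))
      + (2 * Real.pi * Complex.I * k * ktCoef k n g p
        + Complex.I * fderiv ℝ (ktCoef k n g) p (1, 0))
      + b / 2 * ktCoef k n g p = 0 ∧
    ρ * (2 * Real.pi * Complex.I * k * ktCoef k n f p
        - Complex.I * fderiv ℝ (ktCoef k n f) p (1, 0))
      + ((fderiv ℝ (ktCoef k n g) p (0, 1) + 2 * Real.pi * Complex.I * n * p.1 * ktCoef k n g p)
        - ((a - Complex.I) / b) * (2 * Real.pi * Complex.I * n * ktCoef k n g p)) = 0 := by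
  obtain ⟨hf, hg, hfi, hgi, heq⟩ := h
  simp only at hf hg hfi hgi heq
  constructor
  · have := ktCoef_relation k n (c₁ := fun _ => -1)
      (c₂ := fun v => -((v.1 : ℂ) - (a + Complex.I) / b)) (c₃ := fun _ => 1)
      (c₄ := fun _ => Complex.I) (c₅ := fun _ => b / 2) (A := dY f) (B := dZ f) (C := dT g)
      (D := dX g) (E := g) (by fun_prop) (by fun_prop) (by fun_prop) (by fun_prop) (by fun_prop)
      (continuous_fderiv_apply hf _) (continuous_fderiv_apply hf _) (continuous_fderiv_apply hg _)
      (continuous_fderiv_apply hg _) hg.continuous (fun q => by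
        have := (heq q).1
        unfold V₂bar V₁bar at this
        linear_combination 2 * this) p
    rw [ktCoef_dY k n hf, ktCoef_dZ k n hf hfi, ktCoef_dT k n hg hgi, ktCoef_dX k n hg] at this
    linear_combination this
  · have := ktCoef_relation k n (c₁ := fun _ => ρ)
      (c₂ := fun _ => -(ρ * Complex.I)) (c₃ := fun _ => 1)
      (c₄ := fun v => (v.1 : ℂ) - (a - Complex.I) / b) (c₅ := fun _ => 0)
      (A := dT f) (B := dX f) (C := dY g)
      (D := dZ g) (E := g) (by fun_prop) (by fun_prop) (by fun_prop) (by fun_prop) (by fun_prop)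
      (continuous_fderiv_apply hf _) (continuous_fderiv_apply hf _) (continuous_fderiv_apply hg _)
      (continuous_fderiv_apply hg _) hg.continuous (fun q => by
        have := (heq q).2
        unfold V₂ V₁ at this
        linear_combination 2 * this) p
    rw [ktCoef_dY k n hg, ktCoef_dZ k n hg hgi, ktCoef_dT k n hf hfi, ktCoef_dX k n hf] at this
    linear_combination this

theorem ktCoef_solution_eq_zero {a b ρ : ℝ} (hb : b ≠ 0) (hρ : 0 < ρ)
    (htr : Transcendental ℚ (b ^ 2 * √ρ / (8 * Real.pi))) {f g : ℝ × ℝ × ℝ × ℝ → ℂ}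
    (h : (f, g) ∈ solutionSet a b ρ) (k : ℤ) {n : ℤ} (hn : n ≠ 0) :
    ktCoef k n f = 0 ∧ ktCoef k n g = 0 := by
  have := quasiPeriodic_system_eq_zero (a := a) hb hρ htr (k := k) hn
    (φ := ⟨ktCoef k n f, ktCoef_mem_quasiPeriodic k n h.1 h.2.2.1⟩)
    (ψ := ⟨ktCoef k n g, ktCoef_mem_quasiPeriodic k n h.2.1 h.2.2.2.1⟩)
    (fun p => (ktCoef_solution h k n p).1) (fun p => (ktCoef_solution h k n p).2)
  exact ⟨congrArg Subtype.val this.1, congrArg Subtype.val this.2⟩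

/-- The Fourier coefficients of a biperiodic function on `ℝ²`. -/
noncomputable def torusCoef (l m : ℤ) (φ : ℝ × ℝ → ℂ) : ℂ :=
  fcoef l (fun p : Unit × ℝ => fcoef m φ p.2) ()

section torusCoef

variable {φ : ℝ × ℝ → ℂ} (l m : ℤ)

theorem torusCoef_add {ψ : ℝ × ℝ → ℂ} (hφ : Continuous φ) (hψ : Continuous ψ) :
    torusCoef l m (fun p => φ p + ψ p) = torusCoef l m φ + torusCoef l m ψ := by
  unfold torusCoef
  rw [fcoef_add m hφ hψ]
  exact congrFun (fcoef_add l ((fcoef_continuous m hφ).comp continuous_snd)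
    ((fcoef_continuous m hψ).comp continuous_snd)) ()

theorem torusCoef_const_mul (c : ℂ) (φ : ℝ × ℝ → ℂ) :
    torusCoef l m (fun p => c * φ p) = c * torusCoef l m φ := by
  unfold torusCoef
  rw [fcoef_smul m φ (fun _ => c)]
  exact congrFun (fcoef_smul l (fun p : Unit × ℝ => fcoef m φ p.2) (fun _ => c)) ()

theorem torusCoef_fderiv_fst (hφ : φ ∈ quasiPeriodic 0) :
    torusCoef l m (fun p => fderiv ℝ φ p (1, 0)) =
      2 * Real.pi * Complex.I * l * torusCoef l m φ := by
  have h := fcoef_contDiff m hφ.1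
  unfold torusCoef
  rw [← fcoef_fderiv_last l (G := fun p : Unit × ℝ => fcoef m φ p.2) (h.comp contDiff_snd)]
  · congr 1
    funext p
    rw [← fcoef_fderiv m hφ.1]
    have : (fun p : Unit × ℝ => fcoef m φ p.2) = fcoef m φ ∘ (ContinuousLinearMap.snd ℝ Unit ℝ) :=
      rfl
    rw [this, fderiv_comp p (h.differentiable (by simp) _)
      (ContinuousLinearMap.snd ℝ Unit ℝ).differentiableAt, ContinuousLinearMap.fderiv]
    rfl
  · unfold fcoef
    have := fun y => hφ.2.2 0 y
    simp only [zero_add, neg_zero, echar_zero_left, one_mul] at this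
    simp only [this]

theorem torusCoef_fderiv_snd (hφ : φ ∈ quasiPeriodic 0) :
    torusCoef l m (fun p => fderiv ℝ φ p (0, 1)) =
      2 * Real.pi * Complex.I * m * torusCoef l m φ := by
  have h : fcoef m (fun p => fderiv ℝ φ p (0, 1)) =
      fun x => 2 * Real.pi * Complex.I * m * fcoef m φ x := by
    funext x
    exact fcoef_fderiv_last m hφ.1 x (by simpa using hφ.2.1 x 0)
  unfold torusCoef
  rw [h]
  exact congrFun (fcoef_smul l (fun p : Unit × ℝ => fcoef m φ p.2) (fun _ => _)) ()

theorem eq_zero_of_torusCoef_eq_zero (hφ : φ ∈ quasiPeriodic 0) (h : ∀ l m, torusCoef l m φ = 0) :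
    φ = 0 := by
  have hm : ∀ m, fcoef m φ = 0 := fun m => by
    refine eq_zero_of_fourier_eq_zero (fcoef_contDiff m hφ.1).continuous (fun x => ?_)
      fun l => h l m
    unfold fcoef
    simp only [hφ.2.2, neg_zero, echar_zero_left, one_mul]
  funext ⟨x, y⟩
  exact congrFun (eq_zero_of_fourier_eq_zero (h := fun y => φ (x, y))
    (hφ.1.continuous.comp (Continuous.prodMk_right x)) (hφ.2.1 x)
    fun m => congrFun (hm m) x) y

end torusCoef

theorem eq_zero_of_ktCoef_eq_zero {F : ℝ × ℝ × ℝ × ℝ → ℂ} (hF : ContDiff ℝ (⊤ : ℕ∞) F)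
    (hG : GammaInvariant F) (h : ∀ k n, ktCoef k n F = 0) : F = 0 := by
  have hs := hF.comp ktPerm.contDiff
  have hn : ∀ n, fcoef n (F ∘ ktPerm) = 0 := by
    intro n
    funext ⟨v, t⟩
    refine congrFun (eq_zero_of_fourier_eq_zero (h := fun t => fcoef n (F ∘ ktPerm) (v, t))
      ((fcoef_contDiff n hs).continuous.comp (Continuous.prodMk_right v)) (fun t => ?_)
      fun k => congrFun (h k n) v) t
    unfold fcoef
    refine intervalIntegral.integral_congr fun s _ => ?_
    have := hG t v.1 v.2 s 1 0 0 0
    simp at this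
    simp [ktPerm, this]
  funext ⟨t, x, y, z⟩
  refine congrFun (eq_zero_of_fourier_eq_zero (h := fun z => F (t, x, y, z))
    (hF.continuous.comp (by fun_prop)) (fun z => ?_)
    fun n => congrFun (hn n) ((x, y), t)) z
  have := hG t x y z 0 0 0 1
  simp at this
  simp [this]

theorem torusCoef_relation (l m : ℤ) {c₁ c₂ c₃ : ℂ} {A B C : ℝ × ℝ → ℂ}
    (hA : Continuous A) (hB : Continuous B) (hC : Continuous C)
    (h : ∀ p, c₁ * A p + (c₂ * B p + c₃ * C p) = 0) :
    c₁ * torusCoef l m A + (c₂ * torusCoef l m B + c₃ * torusCoef l m C) = 0 := by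
  have key := congrArg (torusCoef l m) (funext h)
  have h0 : torusCoef l m (fun _ => 0) = 0 := by simp [torusCoef, fcoef]
  rw [h0, torusCoef_add l m (hA.const_mul c₁) ((hB.const_mul c₂).fun_add (hC.const_mul c₃)),
    torusCoef_add l m (hB.const_mul c₂) (hC.const_mul c₃)] at key
  simpa only [torusCoef_const_mul] using key

/-- The Fourier coefficient of a function on the Kodaira–Thurston manifold with indices `k, l, m`
in the variables `t, x, y` and `0` in the variable `z`. -/
noncomputable def ktTorusCoef (k l m : ℤ) (F : ℝ × ℝ × ℝ × ℝ → ℂ) : ℂ :=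
  torusCoef l m (ktCoef k 0 F)

theorem ktTorusCoef_solution {a b ρ : ℝ} {f g : ℝ × ℝ × ℝ × ℝ → ℂ}
    (h : (f, g) ∈ solutionSet a b ρ) (k l m : ℤ) :
    -(2 * Real.pi * Complex.I * m) * ktTorusCoef k l m f
      + (2 * Real.pi * Complex.I * k - 2 * Real.pi * l + b / 2) * ktTorusCoef k l m g = 0 ∧
    ρ * (2 * Real.pi * Complex.I * k + 2 * Real.pi * l) * ktTorusCoef k l m f
      + 2 * Real.pi * Complex.I * m * ktTorusCoef k l m g = 0 := by
  have hf := ktCoef_mem_quasiPeriodic k 0 h.1 h.2.2.1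
  have hg := ktCoef_mem_quasiPeriodic k 0 h.2.1 h.2.2.2.1
  have hs := ktCoef_solution h k 0
  unfold ktTorusCoef
  simp only at hf hg
  generalize ktCoef k 0 f = φ at *
  generalize ktCoef k 0 g = ψ at *
  constructor
  · have := torusCoef_relation l m (c₁ := -1) (c₂ := 2 * Real.pi * Complex.I * k + b / 2)
      (c₃ := Complex.I) (contDiff_fderiv_apply hf.1 (0, 1)).continuous hg.1.continuous
      (contDiff_fderiv_apply hg.1 (1, 0)).continuous (fun p => by
        have := (hs p).1
        push_cast at this
        linear_combination this)
    rw [torusCoef_fderiv_snd l m hf, torusCoef_fderiv_fst l m hg] at this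
    linear_combination this - 2 * Real.pi * l * torusCoef l m ψ * Complex.I_sq
  · have := torusCoef_relation l m (c₁ := 1) (c₂ := ρ * (2 * Real.pi * Complex.I * k))
      (c₃ := -(ρ * Complex.I)) (contDiff_fderiv_apply hg.1 (0, 1)).continuous hf.1.continuous
      (contDiff_fderiv_apply hf.1 (1, 0)).continuous (fun p => by
        have := (hs p).2
        push_cast at this
        linear_combination this)
    rw [torusCoef_fderiv_snd l m hg, torusCoef_fderiv_fst l m hf] at this
    linear_combination this + ρ * 2 * Real.pi * l * torusCoef l m φ * Complex.I_sq

theorem eq_zero_of_ktTorusCoef_eq_zero {a b ρ : ℝ} (hb : b ≠ 0) (hρ : 0 < ρ)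
    (htr : Transcendental ℚ (b ^ 2 * √ρ / (8 * Real.pi))) {f g : ℝ × ℝ × ℝ × ℝ → ℂ}
    (h : (f, g) ∈ solutionSet a b ρ)
    (hc : ∀ k l m, ktTorusCoef k l m f = 0 ∧ ktTorusCoef k l m g = 0) : f = 0 ∧ g = 0 := by
  have h0 : ∀ k n, ktCoef k n f = 0 ∧ ktCoef k n g = 0 := fun k n => by
    rcases eq_or_ne n 0 with rfl | hn
    · exact ⟨eq_zero_of_torusCoef_eq_zero (ktCoef_mem_quasiPeriodic k 0 h.1 h.2.2.1)
        fun l m => (hc k l m).1,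
        eq_zero_of_torusCoef_eq_zero (ktCoef_mem_quasiPeriodic k 0 h.2.1 h.2.2.2.1)
        fun l m => (hc k l m).2⟩
    · exact ktCoef_solution_eq_zero hb hρ htr h k hn
  exact ⟨eq_zero_of_ktCoef_eq_zero h.1 h.2.2.1 fun k n => (h0 k n).1,
    eq_zero_of_ktCoef_eq_zero h.2.1 h.2.2.2.1 fun k n => (h0 k n).2⟩

theorem lattice_of_torus_system {b ρ : ℝ} (hb : b ≠ 0) (hρ : 0 < ρ) {k l m : ℤ} {x y : ℂ}
    (h1 : -(2 * Real.pi * Complex.I * m) * x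
      + (2 * Real.pi * Complex.I * k - 2 * Real.pi * l + b / 2) * y = 0)
    (h2 : ρ * (2 * Real.pi * Complex.I * k + 2 * Real.pi * l) * x
      + 2 * Real.pi * Complex.I * m * y = 0) (hxy : ¬ (x = 0 ∧ y = 0)) :
    k = 0 ∧ (m : ℝ) ^ 2 + ρ * (l : ℝ) ^ 2 - (b * ρ / (4 * Real.pi)) * l = 0 := by
  have hdet : (((2 * Real.pi) *
      (2 * Real.pi * (m ^ 2 + ρ * k ^ 2 + ρ * l ^ 2) - ρ * b / 2 * l) : ℝ) : ℂ)
      + ((-(2 * Real.pi * ρ * b / 2 * k) : ℝ) : ℂ) * Complex.I = 0 := by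
    push_cast
    by_contra hne
    refine hxy ⟨(mul_eq_zero.1 ?_).resolve_left hne, (mul_eq_zero.1 ?_).resolve_left hne⟩
    · linear_combination (2 * Real.pi * Complex.I * m) * h1
        - (2 * Real.pi * Complex.I * k - 2 * Real.pi * l + b / 2) * h2
        + (2 * Real.pi) ^ 2 * (m ^ 2 + ρ * k ^ 2) * x * Complex.I_sq
    · linear_combination -(ρ * (2 * Real.pi * Complex.I * k + 2 * Real.pi * l)) * h1
        - (2 * Real.pi * Complex.I * m) * h2
        + (2 * Real.pi) ^ 2 * (m ^ 2 + ρ * k ^ 2) * y * Complex.I_sq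
  have hre := congrArg Complex.re hdet
  have him := congrArg Complex.im hdet
  simp only [Complex.add_re, Complex.add_im, Complex.ofReal_re, Complex.ofReal_im,
    Complex.re_ofReal_mul, Complex.im_ofReal_mul, Complex.I_re, Complex.I_im, Complex.zero_re, Complex.zero_im, mul_zero,
    add_zero, zero_add, mul_one] at hre him
  have hpi := Real.pi_pos
  have hk : (k : ℝ) = 0 := by
    have : 2 * Real.pi * ρ * b / 2 ≠ 0 := by positivity
    exact (mul_eq_zero.1 (neg_eq_zero.1 him)).resolve_left this
  refine ⟨by exact_mod_cast hk, ?_⟩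
  rw [hk] at hre
  have := (mul_eq_zero.1 hre).resolve_left (by positivity)
  field_simp
  linarith

theorem finite_lattice {ρ : ℝ} (hρ : 0 < ρ) (c : ℝ) :
    {p : ℤ × ℤ | (p.2 : ℝ) ^ 2 + ρ * (p.1 : ℝ) ^ 2 - c * (p.1 : ℝ) = 0}.Finite := by
  set N : ℤ := ⌈|c| / ρ⌉
  set M : ℤ := ⌈|c| * N⌉
  refine ((Set.finite_Icc (-N) N).prod (Set.finite_Icc (-M) M)).subset ?_
  rintro ⟨l, m⟩ h
  simp only [Set.mem_ofPred_eq] at h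
  have hcl : c * l ≤ |c| * |(l : ℝ)| := by rw [← abs_mul]; exact le_abs_self _
  have hl : |(l : ℝ)| ≤ N := by
    refine le_trans ?_ (Int.le_ceil _)
    rw [le_div_iff₀ hρ]
    rcases eq_or_ne (l : ℝ) 0 with h0 | h0
    · simp [h0]
    · have hpos : 0 < |(l : ℝ)| := abs_pos.2 h0
      refine le_of_mul_le_mul_right ?_ hpos
      nlinarith [sq_abs (l : ℝ), sq_nonneg (m : ℝ)]
  have hm : |(m : ℝ)| ≤ M := by
    have h1 : (m : ℝ) ^ 2 ≤ M := by
      refine le_trans ?_ (Int.le_ceil _)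
      have := mul_le_mul_of_nonneg_left hl (abs_nonneg c)
      nlinarith [sq_nonneg (l : ℝ)]
    have h2 : |m| ≤ m ^ 2 := by
      rw [← sq_abs]
      rcases eq_or_ne m 0 with rfl | h0
      · simp
      · nlinarith [Int.one_le_abs h0]
    have h3 : |(m : ℝ)| ≤ (m : ℝ) ^ 2 := by exact_mod_cast h2
    exact h3.trans h1
  have hl' : |l| ≤ N := by exact_mod_cast hl
  have hm' : |m| ≤ M := by exact_mod_cast hm
  exact ⟨abs_le.1 hl', abs_le.1 hm'⟩

theorem fderiv_torus_char (c : ℂ) (l m : ℤ) (p w : ℝ × ℝ × ℝ × ℝ) :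
    fderiv ℝ (fun p : ℝ × ℝ × ℝ × ℝ => c * (echar l p.2.1 * echar m p.2.2.1)) p w =
      c * ((2 * Real.pi * Complex.I * l * w.2.1 + 2 * Real.pi * Complex.I * m * w.2.2.1) *
        (echar l p.2.1 * echar m p.2.2.1)) := by
  have hx : HasFDerivAt (fun p : ℝ × ℝ × ℝ × ℝ => p.2.1)
      ((ContinuousLinearMap.fst ℝ ℝ (ℝ × ℝ)).comp (ContinuousLinearMap.snd ℝ ℝ (ℝ × ℝ × ℝ))) p :=
    ((ContinuousLinearMap.fst ℝ ℝ (ℝ × ℝ)).comp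
      (ContinuousLinearMap.snd ℝ ℝ (ℝ × ℝ × ℝ))).hasFDerivAt
  have hy : HasFDerivAt (fun p : ℝ × ℝ × ℝ × ℝ => p.2.2.1)
      ((ContinuousLinearMap.fst ℝ ℝ ℝ).comp ((ContinuousLinearMap.snd ℝ ℝ (ℝ × ℝ)).comp
        (ContinuousLinearMap.snd ℝ ℝ (ℝ × ℝ × ℝ)))) p :=
    ((ContinuousLinearMap.fst ℝ ℝ ℝ).comp ((ContinuousLinearMap.snd ℝ ℝ (ℝ × ℝ)).comp
        (ContinuousLinearMap.snd ℝ ℝ (ℝ × ℝ × ℝ)))).hasFDerivAt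
  have h1 : HasFDerivAt (fun p : ℝ × ℝ × ℝ × ℝ => echar l p.2.1) _ p :=
    HasFDerivAt.comp (g := echar l) p (hasDerivAt_echar l p.2.1).hasFDerivAt hx
  have h2 : HasFDerivAt (fun p : ℝ × ℝ × ℝ × ℝ => echar m p.2.2.1) _ p :=
    HasFDerivAt.comp (g := echar m) p (hasDerivAt_echar m p.2.2.1).hasFDerivAt hy
  have h3 : HasFDerivAt (fun p : ℝ × ℝ × ℝ × ℝ => c * (echar l p.2.1 * echar m p.2.2.1)) _ p :=
    (h1.mul h2).const_mul c
  rw [h3.fderiv]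
  simp
  ring

theorem torus_char_mem_solutionSet {a b ρ : ℝ} {l m : ℤ} {α β : ℂ}
    (h1 : -(2 * Real.pi * Complex.I * m) * α + (b / 2 - 2 * Real.pi * l) * β = 0)
    (h2 : ρ * (2 * Real.pi * l) * α + 2 * Real.pi * Complex.I * m * β = 0) :
    ((fun p => α * (echar l p.2.1 * echar m p.2.2.1),
      fun p => β * (echar l p.2.1 * echar m p.2.2.1)) :
      ((ℝ × ℝ × ℝ × ℝ) → ℂ) × ((ℝ × ℝ × ℝ × ℝ) → ℂ)) ∈ solutionSet a b ρ := by
  have hs : ∀ c : ℂ, ContDiff ℝ (⊤ : ℕ∞)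
      (fun p : ℝ × ℝ × ℝ × ℝ => c * (echar l p.2.1 * echar m p.2.2.1)) := fun c =>
    contDiff_const.mul (((contDiff_echar l).comp (contDiff_fst.comp contDiff_snd)).mul
      ((contDiff_echar m).comp (contDiff_fst.comp (contDiff_snd.comp contDiff_snd))))
  have hi : ∀ c : ℂ, GammaInvariant
      (fun p : ℝ × ℝ × ℝ × ℝ => c * (echar l p.2.1 * echar m p.2.2.1)) := fun c => by
    intro t x y z α ξ β γ
    simp [echar_add, echar_int]
  refine ⟨hs α, hs β, hi α, hi β, fun q => ?_⟩
  simp only [V₁, V₁bar, V₂, V₂bar, dT, dX, dY, dZ, fderiv_torus_char]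
  push_cast
  constructor
  · linear_combination (1 / 2 * (echar l q.2.1 * echar m q.2.2.1)) * h1
      + Real.pi * l * β * (echar l q.2.1 * echar m q.2.2.1) * Complex.I_sq
  · linear_combination (1 / 2 * (echar l q.2.1 * echar m q.2.2.1)) * h2
      - ρ * Real.pi * l * α * (echar l q.2.1 * echar m q.2.2.1) * Complex.I_sq

theorem integral_echar_mul (m n : ℤ) :
    ∫ s in (0 : ℝ)..1, echar (-m) s * echar n s = if m = n then 1 else 0 := by
  simp only [echar_mul]
  split_ifs with h
  · simp [h, echar_zero_left]
  · have hne : (2 * Real.pi * Complex.I * ((-m + n : ℤ) : ℂ)) ≠ 0 := by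
      have h2 : ((-m + n : ℤ) : ℂ) ≠ 0 := by
        rw [Int.cast_ne_zero]; intro h3; apply h; linarith
      exact mul_ne_zero Complex.two_pi_I_ne_zero h2
    have := intervalIntegral.integral_eq_sub_of_hasDerivAt
      (fun s _ => hasDerivAt_echar (-m + n) s)
      ((continuous_const.mul (continuous_echar (-m + n))).intervalIntegrable 0 1)
    have h1 := echar_int (-m + n) 1
    simp only [Int.cast_one] at h1
    rw [intervalIntegral.integral_const_mul, echar_zero_right, h1, sub_self] at this
    exact (mul_eq_zero.1 this).resolve_left hne

theorem ktTorusCoef_torus_char (c : ℂ) (l m l' m' : ℤ) :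
    ktTorusCoef 0 l' m' (fun p => c * (echar l p.2.1 * echar m p.2.2.1)) =
      if l' = l ∧ m' = m then c else 0 := by
  have h : ktCoef 0 0 (fun p => c * (echar l p.2.1 * echar m p.2.2.1)) =
      fun v => (c * echar l v.1) * echar m v.2 := by
    funext v
    simp [ktCoef, fcoef, ktPerm, echar_zero_left, mul_assoc]
  have h1 : fcoef m' (fun v : ℝ × ℝ => (c * echar l v.1) * echar m v.2) =
      fun x => (c * echar l x) * if m' = m then 1 else 0 := by
    rw [fcoef_smul m' (fun v => echar m v.2) (fun x : ℝ => c * echar l x)]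
    funext x
    rw [fcoef, integral_echar_mul]
  rw [ktTorusCoef, torusCoef, h, h1]
  have h2 : (fun p : Unit × ℝ => (c * echar l p.2) * if m' = m then (1 : ℂ) else 0) =
      fun p => (c * if m' = m then (1 : ℂ) else 0) * echar l p.2 := by
    funext p; ring
  rw [h2, fcoef_smul l' (fun p : Unit × ℝ => echar l p.2)
    (fun _ => c * if m' = m then (1 : ℂ) else 0)]
  simp only [fcoef, integral_echar_mul]
  split_ifs <;> simp_all

/-- The solutions of the `∂̄`-harmonic equations as a vector space. -/
noncomputable def solutionSpace (a b ρ : ℝ) :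
    Submodule ℂ (((ℝ × ℝ × ℝ × ℝ) → ℂ) × ((ℝ × ℝ × ℝ × ℝ) → ℂ)) where
  carrier := solutionSet a b ρ
  zero_mem' := by
    refine ⟨contDiff_const, contDiff_const, fun _ _ _ _ _ _ _ _ => rfl,
      fun _ _ _ _ _ _ _ _ => rfl, fun q => ?_⟩
    simp [V₁, V₁bar, V₂, V₂bar, dT, dX, dY, dZ]
  add_mem' := by
    rintro ⟨f, g⟩ ⟨f', g'⟩ ⟨hf, hg, hfi, hgi, h⟩ ⟨hf', hg', hfi', hgi', h'⟩
    simp only at *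
    refine ⟨hf.add hf', hg.add hg', fun t x y z α ξ β γ => ?_, fun t x y z α ξ β γ => ?_,
      fun q => ?_⟩
    · simp [hfi t x y z α ξ β γ, hfi' t x y z α ξ β γ]
    · simp [hgi t x y z α ξ β γ, hgi' t x y z α ξ β γ]
    · have h1 := fderiv_add (hf.differentiable (by simp) q) (hf'.differentiable (by simp) q)
      have h2 := fderiv_add (hg.differentiable (by simp) q) (hg'.differentiable (by simp) q)
      have hq := h q
      have hq' := h' q
      simp only [V₁, V₁bar, V₂, V₂bar, dT, dX, dY, dZ, Prod.mk_add_mk, h1, h2,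
        add_apply, Pi.add_apply] at hq hq' ⊢
      constructor
      · linear_combination hq.1 + hq'.1
      · linear_combination hq.2 + hq'.2
  smul_mem' := by
    rintro c ⟨f, g⟩ ⟨hf, hg, hfi, hgi, h⟩
    simp only at *
    refine ⟨contDiff_const.mul hf, contDiff_const.mul hg, fun t x y z α ξ β γ => ?_,
      fun t x y z α ξ β γ => ?_, fun q => ?_⟩
    · simp [hfi t x y z α ξ β γ]
    · simp [hgi t x y z α ξ β γ]
    · have h1 := fderiv_const_smul (hf.differentiable (by simp) q) c
      have h2 := fderiv_const_smul (hg.differentiable (by simp) q) c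
      have hq := h q
      simp only [V₁, V₁bar, V₂, V₂bar, dT, dX, dY, dZ, Prod.smul_mk, h1, h2,
        smul_apply, Pi.smul_apply, smul_eq_mul] at hq ⊢
      constructor
      · linear_combination c * hq.1
      · linear_combination c * hq.2

theorem ktTorusCoef_add (k l m : ℤ) {F G : ℝ × ℝ × ℝ × ℝ → ℂ} (hF : ContDiff ℝ (⊤ : ℕ∞) F)
    (hG : ContDiff ℝ (⊤ : ℕ∞) G) :
    ktTorusCoef k l m (F + G) = ktTorusCoef k l m F + ktTorusCoef k l m G := by
  unfold ktTorusCoef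
  rw [← torusCoef_add l m (ktCoef_contDiff k 0 hF).continuous (ktCoef_contDiff k 0 hG).continuous,
    ← ktCoef_add k 0 hF.continuous hG.continuous]
  rfl

theorem ktTorusCoef_smul (k l m : ℤ) (c : ℂ) (F : ℝ × ℝ × ℝ × ℝ → ℂ) :
    ktTorusCoef k l m (c • F) = c * ktTorusCoef k l m F := by
  unfold ktTorusCoef
  rw [← torusCoef_const_mul, ← ktCoef_mul k 0 (fun _ => c)]
  rfl

/-- The Fourier coefficient of a solution which determines its component of frequency `(l, m)`. -/
noncomputable def solutionCoef (a b ρ : ℝ) (s : ℤ × ℤ) : solutionSpace a b ρ →ₗ[ℂ] ℂ where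
  toFun w := if s.1 = 0 then ktTorusCoef 0 s.1 s.2 w.1.1 else ktTorusCoef 0 s.1 s.2 w.1.2
  map_add' w w' := by
    split_ifs
    · exact ktTorusCoef_add 0 s.1 s.2 w.2.1 w'.2.1
    · exact ktTorusCoef_add 0 s.1 s.2 w.2.2.1 w'.2.2.1
  map_smul' c w := by
    split_ifs
    · exact ktTorusCoef_smul 0 s.1 s.2 c _
    · exact ktTorusCoef_smul 0 s.1 s.2 c _

theorem eq_zero_of_solutionCoef_eq_zero {a b ρ : ℝ} (hb : b ≠ 0) (hρ : 0 < ρ)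
    (htr : Transcendental ℚ (b ^ 2 * √ρ / (8 * Real.pi))) (w : solutionSpace a b ρ)
    (hw : ∀ s ∈ {p : ℤ × ℤ | (p.2 : ℝ) ^ 2 + ρ * (p.1 : ℝ) ^ 2
      - (b * ρ / (4 * Real.pi)) * (p.1 : ℝ) = 0}, solutionCoef a b ρ s w = 0) : w = 0 := by
  obtain ⟨⟨f, g⟩, h⟩ := w
  have hfg : f = 0 ∧ g = 0 := by
    refine eq_zero_of_ktTorusCoef_eq_zero hb hρ htr h fun k l m => ?_
    by_contra hne
    have heq := ktTorusCoef_solution h k l m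
    obtain ⟨rfl, hs⟩ := lattice_of_torus_system hb hρ heq.1 heq.2 hne
    have h0 : (if l = 0 then ktTorusCoef 0 l m f else ktTorusCoef 0 l m g) = 0 := hw (l, m) hs
    have hb' : (b : ℂ) ≠ 0 := by exact_mod_cast hb
    have hρ' : (ρ : ℂ) ≠ 0 := by exact_mod_cast hρ.ne'
    have hπ : (Real.pi : ℂ) ≠ 0 := by exact_mod_cast Real.pi_ne_zero
    apply hne
    split_ifs at h0 with hl
    · subst hl
      refine ⟨h0, ?_⟩
      simpa [h0, hb'] using heq.1
    · refine ⟨?_, h0⟩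
      have hl' : (l : ℂ) ≠ 0 := by exact_mod_cast hl
      simpa [h0, hl', hρ', hπ] using heq.2
  exact Subtype.ext (Prod.ext hfg.1 hfg.2)

theorem exists_solution_of_lattice {a b ρ : ℝ} (hρ : 0 < ρ) {s : ℤ × ℤ}
    (hs : s ∈ {p : ℤ × ℤ | (p.2 : ℝ) ^ 2 + ρ * (p.1 : ℝ) ^ 2
      - (b * ρ / (4 * Real.pi)) * (p.1 : ℝ) = 0}) :
    ∃ w : solutionSpace a b ρ, ∀ s', solutionCoef a b ρ s' w = if s' = s then 1 else 0 := by
  obtain ⟨l, m⟩ := s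
  simp only [Set.mem_ofPred_eq] at hs
  suffices h : ∃ α β : ℂ, (if l = 0 then α else β) = 1 ∧
      -(2 * Real.pi * Complex.I * m) * α + (b / 2 - 2 * Real.pi * l) * β = 0 ∧
      ρ * (2 * Real.pi * l) * α + 2 * Real.pi * Complex.I * m * β = 0 by
    obtain ⟨α, β, h0, h1, h2⟩ := h
    refine ⟨⟨_, torus_char_mem_solutionSet h1 h2⟩, ?_⟩
    rintro ⟨l', m'⟩
    change (if l' = 0 then ktTorusCoef 0 l' m' (fun p => α * (echar l p.2.1 * echar m p.2.2.1))
      else ktTorusCoef 0 l' m' (fun p => β * (echar l p.2.1 * echar m p.2.2.1))) = _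
    simp only [ktTorusCoef_torus_char, Prod.mk.injEq]
    split_ifs <;> simp_all
  have hρ' : (ρ : ℂ) ≠ 0 := by exact_mod_cast hρ.ne'
  have hπ : (Real.pi : ℂ) ≠ 0 := by exact_mod_cast Real.pi_ne_zero
  rcases eq_or_ne l 0 with rfl | hl
  · have hm : m = 0 := by simpa using hs
    exact ⟨1, 0, by simp, by simp [hm], by simp⟩
  · have hl' : (l : ℂ) ≠ 0 := by exact_mod_cast hl
    have hs' : (m : ℂ) ^ 2 + ρ * (l : ℂ) ^ 2 - (b * ρ / (4 * Real.pi)) * l = 0 := by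
      exact_mod_cast congrArg Complex.ofReal hs
    refine ⟨-(Complex.I * m) / (ρ * l), 1, by simp [hl], ?_, ?_⟩
    · field_simp at hs' ⊢
      rw [Complex.I_sq]
      linear_combination -hs'
    · field_simp
      ring

theorem rank_solutionSpace {a b ρ : ℝ} (hb : b ≠ 0) (hρ : 0 < ρ)
    (htr : Transcendental ℚ (b ^ 2 * √ρ / (8 * Real.pi))) :
    Module.rank ℂ (solutionSpace a b ρ) =
      (({p : ℤ × ℤ | (p.2 : ℝ) ^ 2 + ρ * (p.1 : ℝ) ^ 2
        - (b * ρ / (4 * Real.pi)) * (p.1 : ℝ) = 0}).ncard : Cardinal) := by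
  have hfin := finite_lattice hρ (b * ρ / (4 * Real.pi))
  have hinj := eq_zero_of_solutionCoef_eq_zero (a := a) hb hρ htr
  have hsurj := fun s => exists_solution_of_lattice (a := a) (b := b) hρ (s := s)
  generalize {p : ℤ × ℤ | (p.2 : ℝ) ^ 2 + ρ * (p.1 : ℝ) ^ 2
        - (b * ρ / (4 * Real.pi)) * (p.1 : ℝ) = 0} = S at *
  have : Fintype S := hfin.fintype
  let Φ : solutionSpace a b ρ →ₗ[ℂ] (S → ℂ) := LinearMap.pi fun s => solutionCoef a b ρ s
  have hΦ : Function.Bijective Φ := by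
    constructor
    · refine (injective_iff_map_eq_zero Φ).2 fun w hw => hinj w fun s hs => ?_
      exact congrFun hw ⟨s, hs⟩
    · intro c
      choose v hv using fun s : S => hsurj s s.2
      refine ⟨∑ s, c s • v s, ?_⟩
      funext s
      simp [Φ, hv, Subtype.ext_iff.symm]
  rw [(LinearEquiv.ofBijective Φ hΦ).rank_eq, rank_fun', ← Nat.card_coe_set_eq,
    Nat.card_eq_fintype_card]

/-- If `b ≠ 0`, `ρ > 0` and `b²√ρ/(8π)` is transcendental, then the
solution space of the `∂̄`-harmonic `(0,1)`-form equations has complex dimension equal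
to the (finite) number of pairs `(l, m) ∈ ℤ²` with `m² + ρl² − (bρ/4π)l = 0`. -/
theorem stmt18 (a b ρ : ℝ) (hb : b ≠ 0) (hρ : 0 < ρ)
    (htr : Transcendental ℚ (b ^ 2 * Real.sqrt ρ / (8 * Real.pi))) :
    ({p : ℤ × ℤ | ((p.2 : ℝ)) ^ 2 + ρ * ((p.1 : ℝ)) ^ 2
        - (b * ρ / (4 * Real.pi)) * ((p.1 : ℝ)) = 0}).Finite ∧
    Module.rank ℂ ↥(Submodule.span ℂ (solutionSet a b ρ)) =
      (({p : ℤ × ℤ | ((p.2 : ℝ)) ^ 2 + ρ * ((p.1 : ℝ)) ^ 2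
        - (b * ρ / (4 * Real.pi)) * ((p.1 : ℝ)) = 0}).ncard : Cardinal) := by
  refine ⟨finite_lattice hρ _, ?_⟩
  have hspan : Submodule.span ℂ (solutionSet a b ρ) = solutionSpace a b ρ :=
    Submodule.span_eq (solutionSpace a b ρ)
  rw [hspan, rank_solutionSpace hb hρ htr]
end
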